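/- arXiv:2105.11014 — 2 statements merged into one kernel-verified Lean document; each statement's English description precedes it below -/
import Mathlib

section
/- Let p be a prime, G ⊆ SL(3, F_p) a finite subgroup, and suppose V = (F_p)³ decomposes as V = F_p v ⊕ W, a direct sum of G-submodules with dim_{F_p} W = 2. Then the invariant ring S(V)^G is Gorenstein. -/
noncomputable section
open CategoryTheory Matrix MvPolynomial

universe u

/-- A module `M` over `R` has finite injective dimension iff the Ext functors
`Ext^i(-, M)` vanish for all sufficiently large `i`. -/
def HasFiniteInjectiveDimension (R : Type u) [CommRing R] (M : ModuleCat.{u} R) : Prop :=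
  ∃ n : ℕ, ∀ (N : ModuleCat.{u} R) (i : ℕ), n < i →
    Subsingleton (((Ext R (ModuleCat.{u} R) i).obj (Opposite.op N)).obj M)

/-- A commutative ring is Gorenstein if it is Noetherian and its localization at every
prime ideal has finite injective dimension over itself. -/
def IsGorensteinRing (R : Type u) [CommRing R] : Prop :=
  IsNoetherianRing R ∧ ∀ (P : Ideal R) [P.IsPrime],
    HasFiniteInjectiveDimension (Localization.AtPrime P)
      (ModuleCat.of (Localization.AtPrime P) (Localization.AtPrime P))

/-- The substitution action of a matrix on polynomials: `X i ↦ ∑ j, M i j • X j`. -/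
def polyAct {F : Type u} [CommSemiring F] {m : ℕ} (M : Matrix (Fin m) (Fin m) F) :
    MvPolynomial (Fin m) F →ₐ[F] MvPolynomial (Fin m) F :=
  MvPolynomial.aeval fun i => ∑ j, M i j • MvPolynomial.X j

/-- The subalgebra of polynomials invariant under a set of matrices. -/
def invariantAlg {F : Type u} [CommSemiring F] {m : ℕ} (S : Set (Matrix (Fin m) (Fin m) F)) :
    Subalgebra F (MvPolynomial (Fin m) F) where
  carrier := {f | ∀ M ∈ S, polyAct M f = f}
  mul_mem' := fun hf hg => fun M hM => by rw [_root_.map_mul, hf M hM, hg M hM]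
  add_mem' := fun hf hg => fun M hM => by rw [_root_.map_add, hf M hM, hg M hM]
  algebraMap_mem' := fun r => fun M hM => (polyAct M).commutes r

/-- The invariant ring `S(V)^G` for a subgroup `G` of `SL(m, F)`, where `S(V)` is realised
as the polynomial ring `F[X 0, …, X (m-1)]`. -/
def invariantRing {F : Type u} [Field F] {m : ℕ}
    (G : Subgroup (Matrix.SpecialLinearGroup (Fin m) F)) :
    Subalgebra F (MvPolynomial (Fin m) F) :=
  invariantAlg {M | ∃ g ∈ G, (g : Matrix (Fin m) (Fin m) F) = M}

/-- A matrix `M` is a transvection if `rank (M - 1) = 1` and `(M - 1)² = 0`. -/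
def IsTransvectionMat {F : Type u} [Field F] {m : ℕ} (M : Matrix (Fin m) (Fin m) F) : Prop :=
  (M - 1).rank = 1 ∧ (M - 1) * (M - 1) = 0

/-- `T(G)`: the subgroup generated by all transvections contained in `G`. -/
def transSubgroup {F : Type u} [Field F] {m : ℕ}
    (G : Subgroup (Matrix.SpecialLinearGroup (Fin m) F)) :
    Subgroup (Matrix.SpecialLinearGroup (Fin m) F) :=
  Subgroup.closure {g | g ∈ G ∧ IsTransvectionMat (g : Matrix (Fin m) (Fin m) F)}

open TensorProduct in
/-- Projective dimension does not increase under flat base change. -/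
theorem hasProjectiveDimensionLE_baseChange {R S : Type u} [CommRing R] [CommRing S] [Algebra R S]
    [Module.Flat R S] (n : ℕ) (M : ModuleCat.{u} R) (h : HasProjectiveDimensionLE M n) :
    HasProjectiveDimensionLE (ModuleCat.of S (S ⊗[R] M)) n := by
  induction n generalizing M with
  | zero =>
    rw [← projective_iff_hasProjectiveDimensionLE_zero, ← IsProjective.iff_projective] at h ⊢
    infer_instance
  | succ n ih =>
    let T := M.projectiveShortComplex
    have hT : T.ShortExact := M.shortExact_projectiveShortComplex
    have h1 := (hT.hasProjectiveDimensionLT_X₃_iff n inferInstance).mp h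
    have hex : Function.Exact T.f.hom T.g.hom :=
      (ShortComplex.ShortExact.moduleCat_exact_iff_function_exact _).mp hT.exact
    have hinj : Function.Injective T.f.hom := (ModuleCat.mono_iff_injective T.f).mp hT.mono_f
    have hsurj : Function.Surjective T.g.hom := (ModuleCat.epi_iff_surjective T.g).mp hT.epi_g
    have hex' : Function.Exact (T.f.hom.baseChange S) (T.g.hom.baseChange S) :=
      Module.Flat.lTensor_exact S hex
    let T' : ShortComplex (ModuleCat.{u} S) :=
      ModuleCat.shortComplexOfCompEqZero (T.f.hom.baseChange S) (T.g.hom.baseChange S)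
        hex'.linearMap_comp_eq_zero
    have hT' : T'.ShortExact := ModuleCat.shortComplex_shortExact T' hex'
      (Module.Flat.lTensor_preserves_injective_linearMap T.f.hom hinj)
      (LinearMap.lTensor_surjective S hsurj)
    have : Projective T'.X₂ :=
      (IsProjective.iff_projective (S ⊗[R] T.X₂)).mp inferInstance
    exact (hT'.hasProjectiveDimensionLT_X₃_iff n this).mpr (ih _ h1)

section PolynomialSyzygy

open TensorProduct Polynomial

variable {R : Type u} [CommRing R] (M : Type u) [AddCommGroup M] [Module R[X] M] [Module R M]
  [IsScalarTower R R[X] M]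

/-- Multiplication by `X` on a module over the polynomial ring, as a map linear over the
coefficients. -/
def mulXLinear : M →ₗ[R] M := (Module.toModuleEnd R[X] M (Polynomial.X : R[X])).restrictScalars R

@[simp] theorem mulXLinear_apply (m : M) : mulXLinear (R := R) M m = (Polynomial.X : R[X]) • m :=
  rfl

/-- The map `f ⊗ m ↦ X f ⊗ m - f ⊗ X m`. -/
def polyKoszul : R[X] ⊗[R] M →ₗ[R[X]] R[X] ⊗[R] M :=
  Module.toModuleEnd R[X] (R[X] ⊗[R] M) (Polynomial.X : R[X]) - (mulXLinear M).baseChange R[X]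

/-- The map `f ⊗ m ↦ f m`. -/
def polyAction : R[X] ⊗[R] M →ₗ[R[X]] M :=
  AlgebraTensorModule.lift ((LinearMap.lsmul R[X] M).flip.restrictScalars R).flip

@[simp] theorem polyKoszul_tmul (f : R[X]) (m : M) :
    polyKoszul M (f ⊗ₜ[R] m) = (Polynomial.X * f) ⊗ₜ m - f ⊗ₜ ((Polynomial.X : R[X]) • m) := by
  simp [polyKoszul, TensorProduct.smul_tmul']

@[simp] theorem polyAction_tmul (f : R[X]) (m : M) : polyAction M (f ⊗ₜ[R] m) = f • m := rfl

/-- The `i`-th coefficient of an element of `R[X] ⊗ M`. -/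
def tensorCoeff (i : ℕ) : R[X] ⊗[R] M →ₗ[R] M :=
  (TensorProduct.lid R M).toLinearMap ∘ₗ (Polynomial.lcoeff R i).rTensor M

omit [Module R[X] M] [IsScalarTower R R[X] M] in
@[simp] theorem tensorCoeff_tmul (i : ℕ) (f : R[X]) (m : M) :
    tensorCoeff M i (f ⊗ₜ[R] m) = f.coeff i • m := rfl

theorem tensorCoeff_succ_polyKoszul (i : ℕ) (t : R[X] ⊗[R] M) :
    tensorCoeff M (i + 1) (polyKoszul M t) =
      tensorCoeff M i t - (Polynomial.X : R[X]) • tensorCoeff M (i + 1) t := by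
  induction t with
  | zero => simp
  | add a b ha hb => simp only [map_add, ha, hb, smul_add]; abel
  | tmul f m =>
    simp only [polyKoszul_tmul, map_sub, tensorCoeff_tmul, Polynomial.coeff_X_mul]
    rw [smul_comm]

omit [Module R[X] M] [IsScalarTower R R[X] M] in
theorem exists_tensorCoeff_eq_zero (t : R[X] ⊗[R] M) :
    ∃ n, ∀ i, n ≤ i → tensorCoeff M i t = 0 := by
  induction t with
  | zero => exact ⟨0, by simp⟩
  | add a b ha hb =>
    obtain ⟨n, hn⟩ := ha
    obtain ⟨k, hk⟩ := hb
    exact ⟨max n k, fun i hi => by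
      rw [map_add, hn i (le_trans (le_max_left _ _) hi), hk i (le_trans (le_max_right _ _) hi),
        add_zero]⟩
  | tmul f m =>
    refine ⟨f.natDegree + 1, fun i hi => ?_⟩
    rw [tensorCoeff_tmul, coeff_eq_zero_of_natDegree_lt (by omega), zero_smul]

omit [Module R[X] M] [IsScalarTower R R[X] M] in
theorem exists_eq_sum_tensorCoeff (t : R[X] ⊗[R] M) :
    ∃ n, ∀ k, n ≤ k →
      t = ∑ i ∈ Finset.range k, (Polynomial.X ^ i : R[X]) ⊗ₜ[R] tensorCoeff M i t := by
  induction t with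
  | zero => exact ⟨0, by simp⟩
  | add a b ha hb =>
    obtain ⟨n, hn⟩ := ha
    obtain ⟨k, hk⟩ := hb
    refine ⟨max n k, fun i hi => ?_⟩
    simp only [map_add, tmul_add, Finset.sum_add_distrib]
    rw [← hn i (le_trans (le_max_left _ _) hi), ← hk i (le_trans (le_max_right _ _) hi)]
  | tmul f m =>
    refine ⟨f.natDegree + 1, fun k hk => ?_⟩
    conv_lhs => rw [f.as_sum_range' k (by omega)]
    rw [sum_tmul]
    refine Finset.sum_congr rfl fun i _ => ?_
    rw [tensorCoeff_tmul, ← smul_tmul, Polynomial.smul_X_eq_monomial]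

theorem polyKoszul_injective : Function.Injective (polyKoszul (R := R) M) := by
  rw [injective_iff_map_eq_zero]
  intro t ht
  have hstep (i : ℕ) : tensorCoeff M i t = (Polynomial.X : R[X]) • tensorCoeff M (i + 1) t := by
    have := tensorCoeff_succ_polyKoszul M i t
    rw [ht, map_zero] at this
    exact (sub_eq_zero.mp this.symm)
  obtain ⟨n, hn⟩ := exists_tensorCoeff_eq_zero M t
  have hall (i : ℕ) : tensorCoeff M i t = 0 := by
    have key : ∀ k, ∀ i, n ≤ i + k → tensorCoeff M i t = 0 := by
      intro k
      induction k with
      | zero => exact fun i hi => hn i hi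
      | succ k ih =>
        intro i hi
        rw [hstep, ih (i + 1) (by omega), smul_zero]
    exact key n i (by omega)
  obtain ⟨k, hk⟩ := exists_eq_sum_tensorCoeff M t
  rw [hk k le_rfl]
  simp [hall]

theorem polyKoszul_exact : Function.Exact (polyKoszul (R := R) M) (polyAction M) := by
  intro t
  constructor
  · intro ht
    have hX (n : ℕ) : ∀ m : M,
        ∃ s, (Polynomial.X ^ n : R[X]) ⊗ₜ[R] m - 1 ⊗ₜ ((Polynomial.X ^ n : R[X]) • m) =
          polyKoszul M s := by
      induction n with
      | zero => exact fun m => ⟨0, by simp⟩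
      | succ n ih =>
        intro m
        obtain ⟨s, hs⟩ := ih ((Polynomial.X : R[X]) • m)
        refine ⟨(Polynomial.X ^ n : R[X]) ⊗ₜ m + s, ?_⟩
        rw [map_add, ← hs, polyKoszul_tmul, pow_succ', ← smul_smul, smul_comm]
        abel
    have key (t : R[X] ⊗[R] M) : ∃ s, t - 1 ⊗ₜ polyAction M t = polyKoszul M s := by
      induction t with
      | zero => exact ⟨0, by simp⟩
      | add a b ha hb =>
        obtain ⟨s, hs⟩ := ha
        obtain ⟨s', hs'⟩ := hb
        exact ⟨s + s', by rw [map_add, map_add, ← hs, ← hs', tmul_add]; abel⟩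
      | tmul f m =>
        rw [polyAction_tmul]
        induction f using Polynomial.induction_on' with
        | add p q hp hq =>
          obtain ⟨s, hs⟩ := hp
          obtain ⟨s', hs'⟩ := hq
          exact ⟨s + s', by rw [map_add, ← hs, ← hs', add_tmul, add_smul, tmul_add]; abel⟩
        | monomial n r =>
          obtain ⟨s, hs⟩ := hX n (r • m)
          refine ⟨s, ?_⟩
          rw [← hs, ← Polynomial.smul_X_eq_monomial, smul_tmul, smul_assoc, smul_comm]
    obtain ⟨s, hs⟩ := key t
    exact ⟨s, by rw [← hs, ht, tmul_zero, sub_zero]⟩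
  · rintro ⟨s, rfl⟩
    induction s with
    | zero => simp
    | add a b ha hb => rw [map_add, map_add, ha, hb, add_zero]
    | tmul f m =>
      rw [polyKoszul_tmul, map_sub, polyAction_tmul, polyAction_tmul, smul_smul, mul_comm, sub_self]

theorem polyAction_surjective : Function.Surjective (polyAction (R := R) M) :=
  fun m => ⟨1 ⊗ₜ m, by simp⟩

end PolynomialSyzygy

open Polynomial TensorProduct in
/-- Hilbert's syzygy theorem: adjoining a variable increases global dimension by at most one. -/
theorem hasProjectiveDimensionLE_polynomial {R : Type u} [CommRing R] (n : ℕ)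
    (h : ∀ M : ModuleCat.{u} R, HasProjectiveDimensionLE M n) (M : ModuleCat.{u} R[X]) :
    HasProjectiveDimensionLE M (n + 1) := by
  let : Module R M := Module.compHom M (Polynomial.C : R →+* R[X])
  have : IsScalarTower R R[X] M := IsScalarTower.of_algebraMap_smul fun r m => rfl
  let T : ShortComplex (ModuleCat.{u} R[X]) :=
    ModuleCat.shortComplexOfCompEqZero (polyKoszul (R := R) M) (polyAction M)
      (polyKoszul_exact M).linearMap_comp_eq_zero
  have hT : T.ShortExact := ModuleCat.shortComplex_shortExact T (polyKoszul_exact M)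
    (polyKoszul_injective M) (polyAction_surjective M)
  have hB : HasProjectiveDimensionLE (ModuleCat.of R[X] (R[X] ⊗[R] M)) n :=
    hasProjectiveDimensionLE_baseChange n (ModuleCat.of R M) (h _)
  exact hT.hasProjectiveDimensionLT_X₃ (n + 1) hB
    (hasProjectiveDimensionLT_of_ge (ModuleCat.of R[X] (R[X] ⊗[R] M)) (n + 1) _ (Nat.le_succ _))

/-- Every module over a field is projective. -/
theorem hasProjectiveDimensionLE_field {F : Type u} [Field F] (M : ModuleCat.{u} F) :
    HasProjectiveDimensionLE M 0 := by
  rw [← projective_iff_hasProjectiveDimensionLE_zero, ← IsProjective.iff_projective]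
  exact Module.Projective.of_free

theorem hasFiniteInjectiveDimension_of_hasInjectiveDimensionLE {R : Type u} [CommRing R]
    (M : ModuleCat.{u} R) (n : ℕ) [HasInjectiveDimensionLE M n] :
    HasFiniteInjectiveDimension R M := by
  refine ⟨n, fun N i hi => ?_⟩
  obtain ⟨k, rfl⟩ : ∃ k, i = k + 1 := ⟨i - 1, by omega⟩
  let P := ProjectiveResolution.of N
  have hz : Limits.IsZero ((P.complex.linearYonedaObj R M).homology (k + 1)) := by
    rw [← HomologicalComplex.exactAt_iff_isZero_homology,
      HomologicalComplex.exactAt_iff' _ k (k + 1) (k + 2) (by simp) (by simp)]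
    rw [ShortComplex.moduleCat_exact_iff]
    intro f hf
    have hf' : P.complex.d (k + 2) (k + 1) ≫ (f : P.complex.X (k + 1) ⟶ M) = 0 := hf
    have : P.extMk (f : P.complex.X (k + 1) ⟶ M) (k + 2) rfl hf' = 0 :=
      Abelian.Ext.eq_zero_of_hasInjectiveDimensionLT _ (n + 1) (by omega)
    obtain ⟨g, hg⟩ := (P.extMk_eq_zero_iff _ _ _ _ k rfl).mp this
    exact ⟨g, hg⟩
  have hz' := hz.of_iso (P.isoExt (k + 1) M)
  exact ModuleCat.subsingleton_of_isZero hz'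

theorem isGorensteinRing_of_hasInjectiveDimensionLE {R : Type u} [CommRing R]
    [IsNoetherianRing R] (n : ℕ) [HasInjectiveDimensionLE (ModuleCat.of R R) n] :
    IsGorensteinRing R := by
  refine ⟨inferInstance, fun P _ => ?_⟩
  have h := ModuleCat.localizedModule_hasInjectiveDimensionLE n P.primeCompl (ModuleCat.of R R)
  have : HasInjectiveDimensionLE
      (ModuleCat.of (Localization.AtPrime P) (Localization.AtPrime P)) n := by
    have hloc := ModuleCat.localizedModule_isLocalizedModule (ModuleCat.of R R) P.primeCompl
    refine (ModuleCat.hasInjectiveDimensionLE_iff_of_linearEquiv ?_ n).mp h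
    exact LinearEquiv.extendScalarsOfIsLocalization P.primeCompl (Localization.AtPrime P)
      (@IsLocalizedModule.linearEquiv R _ P.primeCompl R _ _ _ _ _ _ _ _
        ((ModuleCat.of R R).localizedModuleMkLinearMap P.primeCompl)
        (Algebra.linearMap R (Localization.AtPrime P)) hloc _)
  exact hasFiniteInjectiveDimension_of_hasInjectiveDimensionLE _ n

/-- A linear form `τ : B → C` is a perfect trace if `(a, b) ↦ τ (a * b)` identifies `B` with its
`C`-dual. -/
structure IsPerfectTrace {C B : Type*} [CommRing C] [CommRing B] [Algebra C B] (τ : B →ₗ[C] C) :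
    Prop where
  eq_zero : ∀ a, (∀ b, τ (a * b) = 0) → a = 0
  exists_eq : ∀ φ : B →ₗ[C] C, ∃ a, ∀ b, τ (a * b) = φ b

theorem IsPerfectTrace.ext {C B : Type*} [CommRing C] [CommRing B] [Algebra C B]
    {τ : B →ₗ[C] C} (hτ : IsPerfectTrace τ) {a a' : B} (h : ∀ b, τ (a * b) = τ (a' * b)) :
    a = a' :=
  sub_eq_zero.mp (hτ.eq_zero _ fun b => by rw [sub_mul, map_sub, h, sub_self])

theorem IsPerfectTrace.exists_extend {C B K P : Type*} [CommRing C] [CommRing B] [Algebra C B]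
    {τ : B →ₗ[C] C} (hτ : IsPerfectTrace τ) [AddCommGroup K] [Module C K] [Module B K]
    [IsScalarTower C B K] [AddCommGroup P] [Module C P] [Module B P] [IsScalarTower C B P]
    (i : K →ₗ[B] P) (r : P →ₗ[C] K) (hr : ∀ k, r (i k) = k) (h : K →ₗ[B] B) :
    ∃ h' : P →ₗ[B] B, ∀ k, h' (i k) = h k := by
  choose f hf using fun x : P => hτ.exists_eq
    (τ ∘ₗ h.restrictScalars C ∘ₗ r ∘ₗ (LinearMap.toSpanSingleton B P x).restrictScalars C)
  simp only [LinearMap.comp_apply, LinearMap.restrictScalars_apply,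
    LinearMap.toSpanSingleton_apply] at hf
  refine ⟨{ toFun := f, map_add' := fun x y => ?_, map_smul' := fun b x => ?_ }, fun k => ?_⟩
  · exact hτ.ext fun b => by rw [add_mul, map_add, hf, hf, hf, smul_add, map_add, map_add, map_add]
  · refine hτ.ext fun b' => ?_
    rw [RingHom.id_apply, smul_eq_mul, mul_comm b, mul_assoc, hf, hf, smul_smul, mul_comm b]
  · refine hτ.ext fun b => ?_
    change τ (f (i k) * b) = _
    rw [hf, ← map_smul, hr, map_smul, smul_eq_mul, mul_comm]

theorem projective_restrictScalars_of_free {C B : Type u} [CommRing C] [CommRing B] [Algebra C B]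
    [Module.Projective C B] (X : ModuleCat.{u} B) [Module.Free B X] :
    Projective ((ModuleCat.restrictScalars (algebraMap C B)).obj X) := by
  rw [← IsProjective.iff_projective]
  let : Module C X := Module.compHom X (algebraMap C B)
  have : IsScalarTower C B X := IsScalarTower.of_algebraMap_smul fun r m => rfl
  classical
  exact Module.Projective.of_equiv (((Module.Free.chooseBasis B X).repr.restrictScalars C).trans
    (finsuppLequivDFinsupp C)).symm

open Abelian in
theorem IsPerfectTrace.subsingleton_ext_one {C B : Type u} [CommRing C] [CommRing B] [Algebra C B]
    {τ : B →ₗ[C] C} (hτ : IsPerfectTrace τ) {S : ShortComplex (ModuleCat.{u} B)}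
    (hS : S.ShortExact) [Projective S.X₂]
    (h₃ : Projective ((ModuleCat.restrictScalars (algebraMap C B)).obj S.X₃)) :
    Subsingleton (Ext S.X₃ (ModuleCat.of B B) 1) := by
  have : Projective (S.map (ModuleCat.restrictScalars (algebraMap C B))).X₃ := h₃
  have hs := (hS.map_of_exact (ModuleCat.restrictScalars (algebraMap C B))).splittingOfProjective
  refine subsingleton_of_forall_eq 0 fun x => ?_
  obtain ⟨h, rfl⟩ := Ext.contravariant_sequence_exact₃ hS _ x (Ext.eq_zero_of_projective _)
    (n₀ := 0) (by omega)
  obtain ⟨h, rfl⟩ := (Ext.mk₀_bijective _ _).surjective h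
  let : Module C S.X₁ := Module.compHom S.X₁ (algebraMap C B)
  have : IsScalarTower C B S.X₁ := IsScalarTower.of_algebraMap_smul fun r m => rfl
  let : Module C S.X₂ := Module.compHom S.X₂ (algebraMap C B)
  have : IsScalarTower C B S.X₂ := IsScalarTower.of_algebraMap_smul fun r m => rfl
  let r : S.X₂ →ₗ[C] S.X₁ := hs.r.hom
  obtain ⟨h', hh'⟩ := hτ.exists_extend S.f.hom r
    (fun k => ConcreteCategory.congr_hom hs.f_r k) h.hom
  have : h = S.f ≫ ModuleCat.ofHom h' := by
    ext k
    exact (hh' k).symm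
  rw [this, ← Ext.mk₀_comp_mk₀, hS.extClass_comp_assoc]

open Abelian in
theorem IsPerfectTrace.subsingleton_ext {C B : Type u} [CommRing C] [CommRing B] [Algebra C B]
    [Module.Projective C B] {τ : B →ₗ[C] C} (hτ : IsPerfectTrace τ) (n : ℕ) :
    ∀ N : ModuleCat.{u} B,
      HasProjectiveDimensionLE ((ModuleCat.restrictScalars (algebraMap C B)).obj N) n →
      Subsingleton (Ext N (ModuleCat.of B B) (n + 1)) := by
  have hproj (N : ModuleCat.{u} B) : Projective
      ((ModuleCat.restrictScalars (algebraMap C B)).obj N.projectiveShortComplex.X₂) := by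
    exact projective_restrictScalars_of_free _
  have hproj' (N : ModuleCat.{u} B) : Projective N.projectiveShortComplex.X₂ := by
    rw [← IsProjective.iff_projective]
    exact Module.Projective.of_free
  induction n with
  | zero =>
    intro N hN
    have := hproj' N
    exact hτ.subsingleton_ext_one N.shortExact_projectiveShortComplex
      (projective_iff_hasProjectiveDimensionLT_one.mpr hN)
  | succ n ih =>
    intro N hN
    have hS := N.shortExact_projectiveShortComplex
    have hT := hS.map_of_exact (ModuleCat.restrictScalars (algebraMap C B))
    have := ih N.projectiveShortComplex.X₁
      ((hT.hasProjectiveDimensionLT_X₃_iff n (hproj N)).mp hN)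
    have := hproj' N
    refine subsingleton_of_forall_eq 0 fun x => ?_
    obtain ⟨y, rfl⟩ := Ext.contravariant_sequence_exact₃ hS _ x (Ext.eq_zero_of_projective _)
      (n₀ := n + 1) (by omega)
    rw [Subsingleton.elim y 0, Ext.comp_zero]

theorem IsPerfectTrace.isGorensteinRing {C B : Type u} [CommRing C] [CommRing B] [Algebra C B]
    [Module.Projective C B] [IsNoetherianRing B] {τ : B →ₗ[C] C} (hτ : IsPerfectTrace τ) (n : ℕ)
    (hC : ∀ M : ModuleCat.{u} C, HasProjectiveDimensionLE M n) : IsGorensteinRing B :=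
  have : HasInjectiveDimensionLE (ModuleCat.of B B) n :=
    hasInjectiveDimensionLT_of_enoughProjectives _ _ fun N => hτ.subsingleton_ext n N (hC _)
  isGorensteinRing_of_hasInjectiveDimensionLE n

/-- Gorensteinness descends along a retraction compatible with a perfect trace. -/
theorem IsPerfectTrace.isGorensteinRing_of_retraction {C A B : Type u} [CommRing C] [CommRing A]
    [CommRing B] [Algebra C A] [Algebra C B] [IsNoetherianRing C] [Module.Projective C A]
    [Module.Finite C A] {τ : A →ₗ[C] C} (hτ : IsPerfectTrace τ) (n : ℕ)
    (hC : ∀ M : ModuleCat.{u} C, HasProjectiveDimensionLE M n) (ι : B →ₐ[C] A) (π : A →ₗ[C] B)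
    (hπ : ∀ b a, π (ι b * a) = b * π a) (hπ_one : π 1 = 1) (hτπ : ∀ a, τ (ι (π a)) = τ a) :
    IsGorensteinRing B := by
  have hπι (b : B) : π (ι b) = b := by rw [← mul_one (ι b), hπ, hπ_one, mul_one]
  have hsurj : Function.Surjective π := fun b => ⟨ι b, hπι b⟩
  have : Module.Finite C B := Module.Finite.of_surjective π hsurj
  have : Module.Projective C B :=
    Module.Projective.of_split ι.toLinearMap π (LinearMap.ext hπι)
  have : IsNoetherianRing B := IsNoetherianRing.of_finite C B
  refine IsPerfectTrace.isGorensteinRing (τ := τ ∘ₗ ι.toLinearMap)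
    ⟨fun b hb => ?_, fun φ => ?_⟩ n hC
  · rw [← hπι b, hτ.eq_zero (ι b) fun a => ?_, map_zero]
    rw [← hτπ, hπ]
    exact hb _
  · obtain ⟨a, ha⟩ := hτ.exists_eq (φ ∘ₗ π)
    refine ⟨π a, fun b => ?_⟩
    have := ha (ι b)
    rw [← hτπ, mul_comm, hπ, mul_comm] at this
    simpa [hπι] using this

/-- `τ` is a trace form of the Frobenius extension `f : R → S`, i.e. it is `R`-linear and has
a pair of dual bases. -/
structure IsFrobeniusTrace {R S : Type*} [CommRing R] [CommRing S] (f : R →+* S) (τ : S →+ R) :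
    Prop where
  map_mul : ∀ r s, τ (f r * s) = r * τ s
  exists_dual : ∃ (n : ℕ) (b b' : Fin n → S), ∀ s, ∑ i, f (τ (s * b' i)) * b i = s

theorem IsFrobeniusTrace.comp {R S T : Type*} [CommRing R] [CommRing S] [CommRing T]
    {f : R →+* S} {g : S →+* T} {τ : S →+ R} {σ : T →+ S} (hτ : IsFrobeniusTrace f τ)
    (hσ : IsFrobeniusTrace g σ) : IsFrobeniusTrace (g.comp f) (τ.comp σ) := by
  refine ⟨fun r t => ?_, ?_⟩
  · simp [hσ.map_mul, hτ.map_mul]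
  · obtain ⟨n, b, b', hb⟩ := hτ.exists_dual
    obtain ⟨m, c, c', hc⟩ := hσ.exists_dual
    refine ⟨m * n, fun k => g (b (finProdFinEquiv.symm k).2) * c (finProdFinEquiv.symm k).1,
      fun k => g (b' (finProdFinEquiv.symm k).2) * c' (finProdFinEquiv.symm k).1, fun t => ?_⟩
    rw [finProdFinEquiv.symm.sum_comp
      (fun k => (g.comp f) ((τ.comp σ) (t * (g (b' k.2) * c' k.1))) * (g (b k.2) * c k.1)),
      Fintype.sum_prod_type]
    conv_rhs => rw [← hc t]
    refine Finset.sum_congr rfl fun j _ => ?_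
    conv_rhs => rw [← hb (σ (t * c' j))]
    rw [map_sum, Finset.sum_mul]
    refine Finset.sum_congr rfl fun i _ => ?_
    have : t * (g (b' i) * c' j) = g (b' i) * (t * c' j) := by ring
    simp only [AddMonoidHom.comp_apply, RingHom.comp_apply, _root_.map_mul, this, hσ.map_mul,
      mul_comm (b' i), mul_assoc]

theorem IsFrobeniusTrace.of_ringEquiv {R S : Type*} [CommRing R] [CommRing S] (e : R ≃+* S) :
    IsFrobeniusTrace (e : R →+* S) (e.symm : S →+ R) :=
  ⟨fun r s => by simp, 1, 1, 1, fun s => by simp⟩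

theorem IsFrobeniusTrace.perfect {C A : Type u} [CommRing C] [CommRing A] {f : C →+* A}
    {τ : A →+ C} (hτ : IsFrobeniusTrace f τ) :
    letI := f.toAlgebra
    Module.Finite C A ∧ Module.Projective C A ∧
      ∃ τ' : A →ₗ[C] C, IsPerfectTrace τ' ∧ ∀ a, τ' a = τ a := by
  let : Algebra C A := f.toAlgebra
  have hsmul (c : C) (a : A) : c • a = f c * a := Algebra.smul_def c a
  let τ' : A →ₗ[C] C := { τ with map_smul' := fun c a => by simp [hsmul, hτ.map_mul] }
  have hτ' (a : A) : τ' a = τ a := rfl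
  obtain ⟨n, b, b', hb⟩ := hτ.exists_dual
  let s : (Fin n → C) →ₗ[C] A := Fintype.linearCombination C b
  let r : A →ₗ[C] (Fin n → C) := LinearMap.pi fun i => τ' ∘ₗ LinearMap.mulRight C (b' i)
  have hsr (a : A) : s (r a) = a := by
    conv_rhs => rw [← hb a]
    simp [s, r, Fintype.linearCombination_apply, hsmul, hτ']
  refine ⟨Module.Finite.of_surjective s fun a => ⟨r a, hsr a⟩,
    Module.Projective.of_split r s (LinearMap.ext hsr), τ', ⟨fun a ha => ?_, fun φ => ?_⟩, hτ'⟩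
  · rw [← hb a]
    exact Finset.sum_eq_zero fun i _ => by rw [← hτ', ha, map_zero, zero_mul]
  · refine ⟨∑ i, f (φ (b i)) * b' i, fun a => ?_⟩
    conv_rhs => rw [← hb a]
    simp only [← hsmul, map_sum, map_smul, Finset.sum_mul, hτ']
    refine Finset.sum_congr rfl fun i _ => ?_
    rw [← hτ', smul_mul_assoc, map_smul, hτ', mul_comm (b' i), smul_eq_mul, smul_eq_mul, mul_comm]

section FrobeniusPolynomial

open Polynomial

/-- Apply an additive map to all coefficients of a polynomial. -/
def polynomialMapAdd {S R : Type*} [CommRing S] [CommRing R] (τ : S →+ R) : S[X] →+ R[X] where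
  toFun s := ∑ n ∈ Finset.range (s.natDegree + 1), Polynomial.monomial n (τ (s.coeff n))
  map_zero' := by simp
  map_add' s t := by
    have h (s : S[X]) (n : ℕ) : (∑ n ∈ Finset.range (s.natDegree + 1),
        Polynomial.monomial n (τ (s.coeff n))).coeff n = τ (s.coeff n) := by
      simp only [Polynomial.finsetSum_coeff, Polynomial.coeff_monomial, Finset.sum_ite_eq',
        Finset.mem_range]
      split_ifs with hn
      · rfl
      · rw [Polynomial.coeff_eq_zero_of_natDegree_lt (by omega), map_zero]
    ext n
    rw [Polynomial.coeff_add, h, h, h, Polynomial.coeff_add, map_add]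

@[simp] theorem coeff_polynomialMapAdd {S R : Type*} [CommRing S] [CommRing R] (τ : S →+ R)
    (s : S[X]) (n : ℕ) : (polynomialMapAdd τ s).coeff n = τ (s.coeff n) := by
  simp only [polynomialMapAdd, AddMonoidHom.coe_mk, ZeroHom.coe_mk, Polynomial.finsetSum_coeff,
    Polynomial.coeff_monomial, Finset.sum_ite_eq', Finset.mem_range]
  split_ifs with hn
  · rfl
  · rw [Polynomial.coeff_eq_zero_of_natDegree_lt (by omega), map_zero]

theorem IsFrobeniusTrace.polynomial {R S : Type*} [CommRing R] [CommRing S] {f : R →+* S}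
    {τ : S →+ R} (hτ : IsFrobeniusTrace f τ) :
    IsFrobeniusTrace (Polynomial.mapRingHom f) (polynomialMapAdd τ) := by
  refine ⟨fun r s => ?_, ?_⟩
  · ext n
    simp [Polynomial.coeff_mul, hτ.map_mul]
  · obtain ⟨n, b, b', hb⟩ := hτ.exists_dual
    refine ⟨n, fun i => Polynomial.C (b i), fun i => Polynomial.C (b' i), fun s => ?_⟩
    ext k
    simp [hb]

variable {E : Type*} [CommRing E] [Nontrivial E] {g : E[X]} (hg : g.Monic)

/-- The coefficient of `X ^ d` in the `g`-adic expansion, where `g` has degree `d + 1`. -/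
def adicTop (g : E[X]) (hg : g.Monic) (hd : g.natDegree ≠ 0) (s : E[X]) : E[X] :=
  if h : s.natDegree < g.natDegree then Polynomial.C (s.coeff (g.natDegree - 1))
  else Polynomial.C ((s %ₘ g).coeff (g.natDegree - 1)) +
    Polynomial.X * adicTop g hg hd (s /ₘ g)
termination_by s.natDegree
decreasing_by
  rw [Polynomial.natDegree_divByMonic s hg]
  omega

omit [Nontrivial E] in
theorem adicTop_of_natDegree_lt (hd : g.natDegree ≠ 0) (s : E[X]) (h : s.natDegree < g.natDegree) :
    adicTop g hg hd s = Polynomial.C (s.coeff (g.natDegree - 1)) := by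
  rw [adicTop, dif_pos h]

omit [Nontrivial E] in
theorem adicTop_mul_add (hd : g.natDegree ≠ 0) (q r : E[X]) (h : r.natDegree < g.natDegree) :
    adicTop g hg hd (g * q + r) =
      Polynomial.X * adicTop g hg hd q + Polynomial.C (r.coeff (g.natDegree - 1)) := by
  have hr : r.degree < g.degree := Polynomial.degree_lt_degree h
  obtain ⟨h1, h2⟩ := Polynomial.div_modByMonic_unique q r hg ⟨add_comm _ _, hr⟩
  by_cases hq : q = 0
  · subst hq
    rw [mul_zero, zero_add, adicTop_of_natDegree_lt hg hd r h,
      adicTop_of_natDegree_lt hg hd 0 (by simp; omega)]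
    simp
  · rw [adicTop, dif_neg, h1, h2, add_comm]
    rw [Polynomial.natDegree_add_eq_left_of_natDegree_lt]
    · rw [hg.natDegree_mul' hq]; omega
    · rw [hg.natDegree_mul' hq]; omega

omit [Nontrivial E] in
theorem adic_induction {P : E[X] → Prop} (hg : g.Monic) (hd : g.natDegree ≠ 0)
    (h0 : ∀ r, r.natDegree < g.natDegree → P r)
    (h1 : ∀ q r, P q → r.natDegree < g.natDegree → P (g * q + r)) (s : E[X]) : P s := by
  induction hn : s.natDegree using Nat.strong_induction_on generalizing s with
  | _ n ih =>
    by_cases h : s.natDegree < g.natDegree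
    · exact h0 s h
    · rw [← Polynomial.modByMonic_add_div s g, add_comm]
      refine h1 _ _ (ih _ ?_ _ rfl) (Polynomial.natDegree_modByMonic_lt s hg ?_)
      · rw [Polynomial.natDegree_divByMonic s hg]; omega
      · rintro rfl; simp at hd

theorem adicTop_add (hd : g.natDegree ≠ 0) (s t : E[X]) :
    adicTop g hg hd (s + t) = adicTop g hg hd s + adicTop g hg hd t := by
  have hz : g.degree ≠ ⊥ := by simp [hg.ne_zero]
  have hs (s : E[X]) : ∃ q r, s = g * q + r ∧ r.natDegree < g.natDegree :=
    ⟨s /ₘ g, s %ₘ g, by rw [add_comm, Polynomial.modByMonic_add_div s g],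
      Polynomial.natDegree_modByMonic_lt s hg (by rintro rfl; simp at hd)⟩
  induction s using adic_induction hg hd generalizing t with
  | h0 r hr =>
    obtain ⟨q', r', rfl, hr'⟩ := hs t
    rw [show r + (g * q' + r') = g * q' + (r + r') by ring,
      adicTop_mul_add hg hd _ _ ((Polynomial.natDegree_add_le _ _).trans_lt (max_lt hr hr')),
      adicTop_mul_add hg hd _ _ hr', adicTop_of_natDegree_lt hg hd r hr, Polynomial.coeff_add,
      Polynomial.C_add]
    ring
  | h1 q r ih hr =>
    obtain ⟨q', r', rfl, hr'⟩ := hs t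
    rw [show g * q + r + (g * q' + r') = g * (q + q') + (r + r') by ring,
      adicTop_mul_add hg hd _ _ ((Polynomial.natDegree_add_le _ _).trans_lt (max_lt hr hr')), ih,
      adicTop_mul_add hg hd _ _ hr', adicTop_mul_add hg hd _ _ hr, Polynomial.coeff_add,
      Polynomial.C_add]
    ring

omit [Nontrivial E] in
theorem adicTop_C_mul (hd : g.natDegree ≠ 0) (e : E) (s : E[X]) :
    adicTop g hg hd (Polynomial.C e * s) = Polynomial.C e * adicTop g hg hd s := by
  have hr' (r : E[X]) (hr : r.natDegree < g.natDegree) :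
    (Polynomial.C e * r).natDegree < g.natDegree := (Polynomial.natDegree_C_mul_le e r).trans_lt hr
  induction s using adic_induction hg hd with
  | h0 r hr =>
    rw [adicTop_of_natDegree_lt hg hd r hr, adicTop_of_natDegree_lt hg hd _ (hr' r hr),
      Polynomial.coeff_C_mul, Polynomial.C_mul]
  | h1 q r ih hr =>
    rw [mul_add, mul_left_comm, adicTop_mul_add hg hd _ _ (hr' r hr), ih,
      adicTop_mul_add hg hd _ _ hr, Polynomial.coeff_C_mul, Polynomial.C_mul]
    ring

omit [Nontrivial E] in
/-- Elements dual to the powers of `X` modulo a monic polynomial. -/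
theorem exists_dual_powers (hg : g.Monic) : ∃ b' : ℕ → E[X], ∀ k i, k < g.natDegree →
    i < g.natDegree →
    ((Polynomial.X ^ k * b' i).natDegree < g.natDegree ∧
      (Polynomial.X ^ k * b' i).coeff (g.natDegree - 1) = if i = k then 1 else 0) ∨
    ∃ q r, Polynomial.X ^ k * b' i = g * q + r ∧ q.natDegree < g.natDegree - 1 ∧
      r.natDegree < g.natDegree - 1 ∧ i ≠ k := by
  have hc (m n : ℕ) : (Polynomial.divX^[m] g).coeff n = g.coeff (n + m) := by
    induction m generalizing n with
    | zero => rfl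
    | succ m ih => rw [Function.iterate_succ_apply', Polynomial.coeff_divX, ih]; congr 1; omega
  refine ⟨fun i => Polynomial.divX^[i + 1] g, fun k i hk hi => ?_⟩
  rcases Nat.lt_or_ge i k with hik | hik
  · right
    obtain ⟨j, rfl⟩ := Nat.exists_eq_add_of_lt hik
    refine ⟨Polynomial.X ^ j, Polynomial.X ^ j *
      (Polynomial.X ^ (i + 1) * Polynomial.divX^[i + 1] g - g), by ring,
      (Polynomial.natDegree_X_pow_le j).trans_lt (by omega), ?_, by omega⟩
    have : (Polynomial.X ^ (i + 1) * Polynomial.divX^[i + 1] g - g).natDegree ≤ i := by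
      rw [Polynomial.natDegree_le_iff_coeff_eq_zero]
      intro N hN
      rw [Polynomial.coeff_sub, Polynomial.coeff_X_pow_mul', if_pos (by omega), hc,
        Nat.sub_add_cancel (by omega), sub_self]
    have := Polynomial.natDegree_mul_le_of_le (Polynomial.natDegree_X_pow_le (R := E) j) this
    omega
  · left
    have : (Polynomial.divX^[i + 1] g).natDegree ≤ g.natDegree - 1 - i := by
      rw [Polynomial.natDegree_le_iff_coeff_eq_zero]
      intro N hN
      rw [hc, Polynomial.coeff_eq_zero_of_natDegree_lt (by omega)]
    have := Polynomial.natDegree_mul_le_of_le (Polynomial.natDegree_X_pow_le (R := E) k) this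
    refine ⟨this.trans_lt (by omega), ?_⟩
    rw [Polynomial.coeff_X_pow_mul', if_pos (by omega), hc]
    split_ifs with h
    · subst h
      rw [show g.natDegree - 1 - i + (i + 1) = g.natDegree by omega]
      exact hg
    · exact Polynomial.coeff_eq_zero_of_natDegree_lt (by omega)

/-- Substituting a monic polynomial of positive degree for the variable is a Frobenius extension. -/
theorem exists_isFrobeniusTrace_eval₂ (hg : g.Monic) (hd : g.natDegree ≠ 0) :
    ∃ τ : E[X] →+ E[X], IsFrobeniusTrace (Polynomial.eval₂RingHom Polynomial.C g) τ ∧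
      τ (Polynomial.X ^ (g.natDegree - 1)) = 1 := by
  let τ : E[X] →+ E[X] := AddMonoidHom.mk' (adicTop g hg hd) (adicTop_add hg hd)
  have hmul (r s : E[X]) : τ (Polynomial.eval₂RingHom Polynomial.C g r * s) = r * τ s := by
    induction r using Polynomial.induction_on' with
    | add p q hp hq => rw [map_add, add_mul, map_add, hp, hq, add_mul]
    | monomial n e =>
      rw [Polynomial.coe_eval₂RingHom, Polynomial.eval₂_monomial, mul_assoc,
        ← Polynomial.C_mul_X_pow_eq_monomial, mul_assoc]
      refine (adicTop_C_mul hg hd _ _).trans ?_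
      congr 1
      change τ _ = _
      induction n with
      | zero => simp
      | succ n ih =>
        rw [pow_succ', mul_assoc, pow_succ', mul_assoc, ← ih, ← add_zero (g * _)]
        refine (adicTop_mul_add hg hd _ 0 (by simp; omega)).trans ?_
        rw [Polynomial.coeff_zero, Polynomial.C_0, add_zero]
        rfl
  have hlt (s : E[X]) (h : s.natDegree < g.natDegree) :
      τ s = Polynomial.C (s.coeff (g.natDegree - 1)) := adicTop_of_natDegree_lt hg hd s h
  refine ⟨τ, ⟨hmul, ?_⟩, ?_⟩
  · obtain ⟨b', hb'⟩ := exists_dual_powers hg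
    have hδ (k i : ℕ) (hk : k < g.natDegree) (hi : i < g.natDegree) :
        τ (Polynomial.X ^ k * b' i) = if i = k then 1 else 0 := by
      rcases hb' k i hk hi with ⟨h1, h2⟩ | ⟨q, r, h1, h2, h3, h4⟩
      · rw [hlt _ h1, h2]
        split_ifs <;> simp
      · rw [h1]
        refine (adicTop_mul_add hg hd q r (by omega)).trans ?_
        rw [Polynomial.coeff_eq_zero_of_natDegree_lt h3, adicTop_of_natDegree_lt hg hd q (by omega),
          Polynomial.coeff_eq_zero_of_natDegree_lt h2, if_neg h4]
        simp
    refine ⟨g.natDegree, fun i => Polynomial.X ^ (i : ℕ), fun i => b' i, fun s => ?_⟩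
    have hred (r : E[X]) (hr : r.natDegree < g.natDegree) :
        ∑ i : Fin g.natDegree, Polynomial.eval₂RingHom Polynomial.C g (τ (r * b' i)) *
          Polynomial.X ^ (i : ℕ) = r := by
      conv_rhs => rw [r.as_sum_range' _ hr]
      conv_lhs => rw [r.as_sum_range' _ hr]
      simp only [Finset.sum_mul, map_sum]
      rw [Finset.sum_comm]
      refine Finset.sum_congr rfl fun k hk => ?_
      have hk := Finset.mem_range.mp hk
      have (i : Fin g.natDegree) : τ (Polynomial.monomial k (r.coeff k) * b' i) =
          Polynomial.C (r.coeff k) * if i = ⟨k, hk⟩ then 1 else 0 := by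
        rw [← Polynomial.C_mul_X_pow_eq_monomial, mul_assoc]
        refine (adicTop_C_mul hg hd _ _).trans (congrArg _ ((hδ k i hk i.2).trans ?_))
        simp [Fin.ext_iff]
      simp only [this, _root_.map_mul, Polynomial.coe_eval₂RingHom, Polynomial.eval₂_C]
      rw [Fintype.sum_eq_single ⟨k, hk⟩ fun i hi => by rw [if_neg hi]; simp]
      simp [Polynomial.C_mul_X_pow_eq_monomial]
    induction s using adic_induction hg hd with
    | h0 r hr => exact hred r hr
    | h1 q r ih hr =>
      have h2 (i : Fin g.natDegree) : τ ((g * q + r) * b' i) =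
          Polynomial.X * τ (q * b' i) + τ (r * b' i) := by
        rw [← hmul, Polynomial.coe_eval₂RingHom, Polynomial.eval₂_X, add_mul, map_add, mul_assoc]
      calc _ = ∑ i : Fin g.natDegree, (g * (Polynomial.eval₂RingHom Polynomial.C g (τ (q * b' i)) *
            Polynomial.X ^ (i : ℕ)) + Polynomial.eval₂RingHom Polynomial.C g (τ (r * b' i)) *
            Polynomial.X ^ (i : ℕ)) := by
              refine Finset.sum_congr rfl fun i _ => ?_
              rw [h2, map_add, _root_.map_mul, Polynomial.coe_eval₂RingHom, Polynomial.eval₂_X]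
              ring
        _ = g * q + r := by rw [Finset.sum_add_distrib, ← Finset.mul_sum, ih, hred r hr]
  · rw [hlt _ (by rw [Polynomial.natDegree_X_pow]; omega)]
    simp

end FrobeniusPolynomial

/-- Every ring isomorphic to the subring of `A` with underlying set `S` is Gorenstein. -/
def IsGorensteinImage {A : Type u} [CommRing A] (S : Set A) : Prop :=
  ∀ (B : Type u) [CommRing B] (ι : B →+* A), Function.Injective ι → Set.range ι = S →
    IsGorensteinRing B

theorem exists_lift_of_range_subset {A B C : Type*} [CommRing A] [CommRing B] [CommRing C]
    (j : C →+* A) (hj : Function.Injective j) (ι : B →+* A) (h : Set.range ι ⊆ Set.range j) :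
    ∃ ι' : B →+* C, ∀ b, j (ι' b) = ι b := by
  choose f hf using fun b => h ⟨b, rfl⟩
  exact ⟨{ toFun := f
           map_one' := hj (by rw [hf, map_one, map_one])
           map_zero' := hj (by rw [hf, map_zero, map_zero])
           map_add' := fun a b => hj (by rw [map_add, hf, hf, hf, map_add])
           map_mul' := fun a b => hj (by
            rw [_root_.map_mul, hf, hf, hf, _root_.map_mul]) }, hf⟩

theorem IsGorensteinImage.of_preimage {A C : Type u} [CommRing A] [CommRing C] (j : C →+* A)
    (hj : Function.Injective j) {S : Set A} (hS : S ⊆ Set.range j)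
    (h : IsGorensteinImage (j ⁻¹' S)) : IsGorensteinImage S := by
  intro B _ ι hι hιS
  obtain ⟨ι', hι'⟩ := exists_lift_of_range_subset j hj ι (hιS.trans_subset hS)
  refine h B ι' (fun a b hab => hι ?_) ?_
  · rw [← hι', ← hι', hab]
  · ext c
    rw [Set.mem_preimage, ← hιS]
    exact ⟨fun ⟨b, hb⟩ => ⟨b, by rw [← hι', hb]⟩, fun ⟨b, hb⟩ => ⟨b, hj (by rw [hι', hb])⟩⟩

/-- Invariants of a nonmodular finite group preserving a Frobenius trace are Gorenstein. -/
theorem IsFrobeniusTrace.isGorensteinImage_fixed {C A : Type u} [CommRing C] [CommRing A]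
    [IsNoetherianRing C] (n : ℕ) (hC : ∀ M : ModuleCat.{u} C, HasProjectiveDimensionLE M n)
    {f : C →+* A} {τ : A →+ C} (hτ : IsFrobeniusTrace f τ)
    {D : Type*} [Group D] [Finite D] (ρ : D → A →+* A)
    (hρ : ∀ a b x, ρ (a * b) x = ρ b (ρ a x))
    (hD : IsUnit (Nat.card D : C)) (hρf : ∀ d c, ρ d (f c) = f c)
    (hρτ : ∀ d a, τ (ρ d a) = τ a) : IsGorensteinImage {a | ∀ d, ρ d a = a} := by
  intro B _ ι hι hιS
  have := Fintype.ofFinite D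
  obtain ⟨φ, hφ⟩ := exists_lift_of_range_subset ι hι f (by
    rw [hιS]
    rintro _ ⟨c, rfl⟩ d
    exact hρf d c)
  obtain ⟨e, he⟩ := hD.exists_left_inv
  have hfix (a : A) (d : D) : ρ d (∑ d', ρ d' a) = ∑ d', ρ d' a := by
    rw [map_sum]
    simp only [← hρ]
    exact Fintype.sum_equiv (Equiv.mulRight d) _ _ fun _ => rfl
  let avg (a : A) : A := f e * ∑ d, ρ d a
  have havg (a : A) : ∃ b, ι b = avg a := by
    have : avg a ∈ Set.range ι := by
      rw [hιS]
      intro d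
      rw [_root_.map_mul, hρf, hfix]
    exact this
  choose π hπ using havg
  have hιfix (b : B) (d : D) : ρ d (ι b) = ι b := by
    have : ι b ∈ {a | ∀ d, ρ d a = a} := hιS ▸ ⟨b, rfl⟩
    exact this d
  have hmul (b : B) (a : A) : π (ι b * a) = b * π a := by
    apply hι
    rw [_root_.map_mul, hπ, hπ]
    simp only [avg, _root_.map_mul, hιfix, ← Finset.mul_sum]
    ring
  obtain ⟨hfin, hproj, τ', hτ', hττ'⟩ := hτ.perfect
  let : Algebra C A := f.toAlgebra
  let : Algebra C B := φ.toAlgebra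
  have hsmulA (c : C) (a : A) : c • a = f c * a := Algebra.smul_def c a
  have hsmulB (c : C) (b : B) : c • b = φ c * b := Algebra.smul_def c b
  let π' : A →ₗ[C] B :=
    { toFun := π
      map_add' := fun a b => hι (by
        rw [map_add, hπ, hπ, hπ]
        simp only [avg, map_add, Finset.sum_add_distrib, mul_add])
      map_smul' := fun c a => by
        rw [RingHom.id_apply, hsmulA, hsmulB, ← hφ, hmul] }
  refine hτ'.isGorensteinRing_of_retraction n hC { ι with commutes' := hφ } π' hmul (hι ?_) ?_
  · have : (∑ d : D, ρ d 1) = f (Nat.card D) := by simp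
    change ι (π 1) = ι 1
    rw [map_one ι, hπ]
    simp only [avg, this]
    rw [← _root_.map_mul, he, map_one]
  · intro a
    have : ι (π a) = e • ∑ d, ρ d a := by rw [hπ, hsmulA]
    change τ' (ι (π a)) = τ' a
    rw [this, map_smul, map_sum]
    simp only [hττ', hρτ, Finset.sum_const, Finset.card_univ, ← Nat.card_eq_fintype_card]
    rw [nsmul_eq_mul, smul_eq_mul, ← mul_assoc, he, one_mul]

/-- `f` is a Frobenius extension with a trace form with value `1` at `a`. -/
def HasFrobeniusTop {R S : Type*} [CommRing R] [CommRing S] (f : R →+* S) (a : S) : Prop :=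
  ∃ τ, IsFrobeniusTrace f τ ∧ τ a = 1

theorem HasFrobeniusTop.comp {R S T : Type*} [CommRing R] [CommRing S] [CommRing T]
    {f : R →+* S} {g : S →+* T} {a : S} {b : T} (hf : HasFrobeniusTop f a)
    (hg : HasFrobeniusTop g b) : HasFrobeniusTop (g.comp f) (g a * b) := by
  obtain ⟨τ, hτ, hτa⟩ := hf
  obtain ⟨σ, hσ, hσb⟩ := hg
  exact ⟨τ.comp σ, hτ.comp hσ, by rw [AddMonoidHom.comp_apply, hσ.map_mul, hσb, mul_one, hτa]⟩

theorem HasFrobeniusTop.of_ringEquiv {R S : Type*} [CommRing R] [CommRing S] (e : R ≃+* S) :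
    HasFrobeniusTop (e : R →+* S) 1 :=
  ⟨_, .of_ringEquiv e, map_one e.symm⟩

theorem HasFrobeniusTop.polynomial {R S : Type*} [CommRing R] [CommRing S] {f : R →+* S} {a : S}
    (hf : HasFrobeniusTop f a) :
    HasFrobeniusTop (Polynomial.mapRingHom f) (Polynomial.C a) := by
  obtain ⟨τ, hτ, hτa⟩ := hf
  refine ⟨_, hτ.polynomial, ?_⟩
  ext n
  rw [coeff_polynomialMapAdd, Polynomial.coeff_C, Polynomial.coeff_one]
  split_ifs
  · exact hτa
  · exact map_zero τ

theorem Polynomial.Monic.hasFrobeniusTop {E : Type*} [CommRing E] [Nontrivial E]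
    {g : Polynomial E} (hg : g.Monic) {d : ℕ} (hd : g.natDegree = d + 1) :
    HasFrobeniusTop (Polynomial.eval₂RingHom Polynomial.C g) (Polynomial.X ^ d) := by
  obtain ⟨τ, hτ, h⟩ := exists_isFrobeniusTrace_eval₂ hg (by omega)
  exact ⟨τ, hτ, by rwa [hd, Nat.add_sub_cancel] at h⟩

theorem degree_C_mul_X_lt {R : Type*} [CommRing R] (a : R) {n : ℕ} (hn : 1 < n) :
    (Polynomial.C a * Polynomial.X).degree < (n : WithBot ℕ) :=
  (Polynomial.degree_C_mul_X_le _).trans_lt (by exact_mod_cast hn)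

theorem monic_X_pow_sub_C_mul_X {R : Type*} [CommRing R] (a : R) {n : ℕ} (hn : 1 < n) :
    (Polynomial.X ^ n - Polynomial.C a * Polynomial.X).Monic :=
  Polynomial.monic_X_pow_sub (degree_C_mul_X_lt a hn)

theorem natDegree_X_pow_sub_C_mul_X {R : Type*} [CommRing R] [Nontrivial R] (a : R) {n : ℕ}
    (hn : 1 < n) : (Polynomial.X ^ n - Polynomial.C a * Polynomial.X).natDegree = n :=
  Polynomial.natDegree_eq_of_degree_eq_some
    ((Polynomial.degree_sub_eq_left_of_degree_lt (by
      rw [Polynomial.degree_X_pow]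
      exact degree_C_mul_X_lt a hn)).trans (Polynomial.degree_X_pow n))

/-- The polynomial ring in three variables over `𝔽_p`, as an iterated polynomial ring. -/
def TriPoly (p : ℕ) : Type := Polynomial (Polynomial (Polynomial (ZMod p)))

section TriPoly

variable {p : ℕ}

instance : CommRing (TriPoly p) :=
  inferInstanceAs (CommRing (Polynomial (Polynomial (Polynomial (ZMod p)))))

instance : Algebra (ZMod p) (TriPoly p) :=
  inferInstanceAs (Algebra (ZMod p) (Polynomial (Polynomial (Polynomial (ZMod p)))))

instance [Fact p.Prime] : IsDomain (TriPoly p) :=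
  inferInstanceAs (IsDomain (Polynomial (Polynomial (Polynomial (ZMod p)))))

instance [Fact p.Prime] : IsNoetherianRing (TriPoly p) :=
  inferInstanceAs (IsNoetherianRing (Polynomial (Polynomial (Polynomial (ZMod p)))))

instance : CharP (TriPoly p) p :=
  inferInstanceAs (CharP (Polynomial (Polynomial (Polynomial (ZMod p)))) p)

/-- The coefficients of `TriPoly p` as a polynomial in the third variable. -/
def triCoeff : Polynomial (Polynomial (ZMod p)) →+* TriPoly p :=
  (Polynomial.C : _ →+* Polynomial (Polynomial (Polynomial (ZMod p))))

/-- The first (innermost) variable. -/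
def triZ : TriPoly p := triCoeff (Polynomial.C Polynomial.X)

/-- The second variable. -/
def triX : TriPoly p := triCoeff Polynomial.X

/-- The third (outermost) variable. -/
def triY : TriPoly p := (Polynomial.X : Polynomial (Polynomial (Polynomial (ZMod p))))

/-- The substitution `z ↦ a, x ↦ b, y ↦ c`. -/
def triSubst {S : Type*} [CommRing S] [Algebra (ZMod p) S] (a b c : S) : TriPoly p →+* S :=
  (Polynomial.eval₂RingHom (Polynomial.eval₂RingHom
    (Polynomial.eval₂RingHom (algebraMap (ZMod p) S) a) b) c :
    Polynomial (Polynomial (Polynomial (ZMod p))) →+* S)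

section

variable {S : Type*} [CommRing S] [Algebra (ZMod p) S] (a b c : S)

theorem triSubst_coeff (q : Polynomial (Polynomial (ZMod p))) :
    triSubst a b c (triCoeff q) = Polynomial.eval₂ (Polynomial.eval₂RingHom
      (algebraMap (ZMod p) S) a) b q :=
  Polynomial.eval₂_C _ _

@[simp] theorem triSubst_Z : triSubst a b c (triZ (p := p)) = a := by
  simp [triSubst_coeff, triZ]

@[simp] theorem triSubst_X : triSubst a b c (triX (p := p)) = b := by
  simp [triSubst_coeff, triX]

@[simp] theorem triSubst_Y : triSubst a b c (triY (p := p)) = c :=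
  Polynomial.eval₂_X _ _

end

theorem triPoly_hom_ext {S : Type*} [CommRing S] {f g : TriPoly p →+* S}
    (hz : f triZ = g triZ) (hx : f triX = g triX) (hy : f triY = g triY) : f = g :=
  Polynomial.ringHom_ext' (R := Polynomial (Polynomial (ZMod p))) (Polynomial.ringHom_ext'
    (Polynomial.ringHom_ext' (Subsingleton.elim _ _) hz) hx) hy

@[simp] theorem triPoly_hom_algebraMap (f : TriPoly p →+* TriPoly p) (c : ZMod p) :
    f (algebraMap _ _ c) = algebraMap _ _ c :=
  RingHom.congr_fun (Subsingleton.elim (f.comp (algebraMap (ZMod p) _)) (algebraMap _ _)) c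

variable [Fact p.Prime]

theorem hasProjectiveDimensionLE_triPoly (M : ModuleCat.{0} (TriPoly p)) :
    HasProjectiveDimensionLE M 3 :=
  hasProjectiveDimensionLE_polynomial 2 (hasProjectiveDimensionLE_polynomial 1
    (hasProjectiveDimensionLE_polynomial 0 hasProjectiveDimensionLE_field)) M

theorem exists_algebraMap_of_isUnit {u : TriPoly p} (hu : IsUnit u) :
    ∃ c : ZMod p, algebraMap _ _ c = u := by
  obtain ⟨v, hv, rfl⟩ := Polynomial.isUnit_iff.mp hu
  obtain ⟨w, hw, rfl⟩ := Polynomial.isUnit_iff.mp hv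
  obtain ⟨c, -, rfl⟩ := Polynomial.isUnit_iff.mp hw
  exact ⟨c, rfl⟩

/-- `HasFrobeniusTop` for endomorphisms of `TriPoly p`. -/
abbrev TriHasFrobeniusTop (f : TriPoly p →+* TriPoly p) (a : TriPoly p) : Prop :=
  HasFrobeniusTop (R := TriPoly p) (S := TriPoly p) f a

omit [Fact p.Prime] in
theorem TriHasFrobeniusTop.congr {f g : TriPoly p →+* TriPoly p} {a b : TriPoly p}
    (h : TriHasFrobeniusTop f a) (hz : g triZ = f triZ) (hx : g triX = f triX)
    (hy : g triY = f triY) (hab : b = a) : TriHasFrobeniusTop g b := by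
  obtain rfl : g = f := triPoly_hom_ext hz hx hy
  rwa [hab]

theorem hasFrobeniusTop_triY {g : Polynomial (Polynomial (Polynomial (ZMod p)))} (hg : g.Monic)
    {d : ℕ} (hd : g.natDegree = d + 1) :
    TriHasFrobeniusTop (triSubst (p := p) triZ triX g) (triY ^ d) :=
  TriHasFrobeniusTop.congr (hg.hasFrobeniusTop hd)
    ((triSubst_Z _ _ _).trans (Polynomial.eval₂_C Polynomial.C g).symm)
    ((triSubst_X _ _ _).trans (Polynomial.eval₂_C Polynomial.C g).symm)
    ((triSubst_Y _ _ _).trans (Polynomial.eval₂_X Polynomial.C g).symm) rfl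

theorem hasFrobeniusTop_triX {d : ℕ} :
    TriHasFrobeniusTop (triSubst (p := p) triZ (triX ^ (d + 1)) triY) (triX ^ d) := by
  let f : Polynomial (Polynomial (ZMod p)) →+* Polynomial (Polynomial (ZMod p)) :=
    Polynomial.eval₂RingHom Polynomial.C (Polynomial.X ^ (d + 1))
  have hf : HasFrobeniusTop f (Polynomial.X ^ d) :=
    (Polynomial.monic_X_pow (R := Polynomial (ZMod p)) (d + 1)).hasFrobeniusTop
      (Polynomial.natDegree_X_pow _)
  refine TriHasFrobeniusTop.congr hf.polynomial ((triSubst_Z _ _ _).trans ?_)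
    ((triSubst_X _ _ _).trans ?_) ((triSubst_Y _ _ _).trans (Polynomial.map_X f).symm)
    (map_pow triCoeff _ _).symm
  · refine Eq.trans ?_ (Polynomial.map_C f).symm
    simp [f, triZ, triCoeff]
    rfl
  · refine Eq.trans ?_ (Polynomial.map_C f).symm
    simp only [f, Polynomial.coe_eval₂RingHom, Polynomial.eval₂_X]
    exact (map_pow triCoeff _ _).symm

theorem hasFrobeniusTop_triZ {d : ℕ} :
    TriHasFrobeniusTop (triSubst (p := p) (triZ ^ (d + 1)) triX triY) (triZ ^ d) := by
  let f : Polynomial (ZMod p) →+* Polynomial (ZMod p) :=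
    Polynomial.eval₂RingHom Polynomial.C (Polynomial.X ^ (d + 1))
  have hf : HasFrobeniusTop f (Polynomial.X ^ d) :=
    (Polynomial.monic_X_pow (R := ZMod p) (d + 1)).hasFrobeniusTop (Polynomial.natDegree_X_pow _)
  have hZ (n : ℕ) : triZ ^ n = triCoeff (p := p) (Polynomial.C (Polynomial.X ^ n)) := by
    rw [map_pow, map_pow, triZ]
  refine TriHasFrobeniusTop.congr hf.polynomial.polynomial ((triSubst_Z _ _ _).trans ?_)
    ((triSubst_X _ _ _).trans ?_)
    ((triSubst_Y _ _ _).trans (Polynomial.map_X (Polynomial.mapRingHom f)).symm) (hZ d)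
  · refine Eq.trans ?_ (Polynomial.map_C (Polynomial.mapRingHom f)).symm
    simp only [f, Polynomial.coe_mapRingHom, Polynomial.map_C, Polynomial.coe_eval₂RingHom,
      Polynomial.eval₂_X]
    exact hZ _
  · refine Eq.trans ?_ (Polynomial.map_C (Polynomial.mapRingHom f)).symm
    simp only [Polynomial.coe_mapRingHom, Polynomial.map_X]
    rfl

theorem hasFrobeniusTop_triSwap :
    TriHasFrobeniusTop (triSubst (p := p) triZ triY triX) 1 := by
  let e : TriPoly p ≃+* TriPoly p :=
    (Polynomial.Bivariate.swap (R := Polynomial (ZMod p))).toRingEquiv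
  have hz : e triZ = triZ := Polynomial.Bivariate.swap_C_C _
  have hx : e triX = triY := Polynomial.Bivariate.swap_X
  have hy : e triY = triX := Polynomial.Bivariate.swap_Y
  have he : TriHasFrobeniusTop (e : TriPoly p →+* TriPoly p) 1 :=
    HasFrobeniusTop.of_ringEquiv (R := TriPoly p) (S := TriPoly p) e
  exact he.congr
    ((triSubst_Z _ _ _).trans hz.symm) ((triSubst_X _ _ _).trans hx.symm)
    ((triSubst_Y _ _ _).trans hy.symm) rfl

theorem hasFrobeniusTop_triY_pow {d : ℕ} :
    TriHasFrobeniusTop (triSubst (p := p) triZ triX (triY ^ (d + 1))) (triY ^ d) :=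
  hasFrobeniusTop_triY (Polynomial.monic_X_pow (d + 1)) (Polynomial.natDegree_X_pow (d + 1))

/-- The norm form `y ^ p - x ^ (p - 1) y`. -/
def triN : TriPoly p := triY ^ p - triX ^ (p - 1) * triY

theorem triN_eq : (triN : TriPoly p) = (Polynomial.X ^ p -
    Polynomial.C (Polynomial.X ^ (p - 1)) * Polynomial.X :
      Polynomial (Polynomial (Polynomial (ZMod p)))) := by
  rw [triN, triX, ← map_pow]
  rfl

theorem hasFrobeniusTop_triN :
    TriHasFrobeniusTop (triSubst (p := p) triZ triX triN) (triY ^ (p - 1)) := by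
  have hp := (Fact.out : p.Prime).one_lt
  rw [triN_eq]
  exact hasFrobeniusTop_triY (monic_X_pow_sub_C_mul_X _ hp)
    ((natDegree_X_pow_sub_C_mul_X _ hp).trans (by omega))

theorem hasFrobeniusTop_dickson :
    TriHasFrobeniusTop (p := p) (triSubst (triZ ^ (p - 1)) (triN ^ (p - 1) + triX ^ (p * (p - 1)))
      (- (triN ^ (p - 1) * triX ^ (p - 1))))
      (triZ ^ (p - 2) * triX ^ (p * (p - 1)) * triN ^ (p - 2) * triX ^ (p - 2) *
        triY ^ (p - 1)) := by
  have hp := (Fact.out : p.Prime).two_le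
  have h1 : p - 2 + 1 = p - 1 := by omega
  have hpow (k : ℕ) : (triX : TriPoly p) ^ (k * (p - 1)) = (triX ^ (p - 1)) ^ k := by
    rw [← pow_mul, mul_comm]
  have hstep : TriHasFrobeniusTop (triSubst (p := p) triZ triX (triY ^ (p + 1) - triX * triY))
      (triY ^ p) :=
    hasFrobeniusTop_triY (monic_X_pow_sub_C_mul_X Polynomial.X (by omega))
      (natDegree_X_pow_sub_C_mul_X _ (by omega))
  have hshift : TriHasFrobeniusTop (triSubst (p := p) triZ triX (triY + triX ^ p)) (triY ^ 0) := by
    rw [triX, ← map_pow]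
    exact hasFrobeniusTop_triY (Polynomial.monic_X_add_C _) (Polynomial.natDegree_X_add_C _)
  refine TriHasFrobeniusTop.congr (((((((hasFrobeniusTop_triZ (p := p) (d := p - 2)).comp
    hstep).comp hasFrobeniusTop_triSwap).comp hshift).comp
    (hasFrobeniusTop_triY_pow (d := p - 2))).comp
    (hasFrobeniusTop_triX (d := p - 2))).comp hasFrobeniusTop_triN) ?_ ?_ ?_ ?_
  · simp [h1]
  · simp [h1, hpow]
  · simp [h1]
    ring
  · simp [hpow, h1]

end TriPoly

theorem IsFrobeniusTrace.eq_zero {R S : Type*} [CommRing R] [CommRing S] {f : R →+* S}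
    {τ : S →+ R} (hτ : IsFrobeniusTrace f τ) {s : S} (h : ∀ a, τ (s * a) = 0) : s = 0 := by
  obtain ⟨n, b, b', hb⟩ := hτ.exists_dual
  simpa [h] using (hb s).symm

theorem IsFrobeniusTrace.exists_eq_mul {R S : Type*} [CommRing R] [CommRing S] {f : R →+* S}
    {τ : S →+ R} (hτ : IsFrobeniusTrace f τ) {φ : S →+ R}
    (hφ : ∀ r s, φ (f r * s) = r * φ s) : ∃ u, ∀ a, φ a = τ (u * a) := by
  obtain ⟨n, b, b', hb⟩ := hτ.exists_dual
  refine ⟨∑ i, f (φ (b i)) * b' i, fun a => ?_⟩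
  conv_lhs => rw [← hb a]
  rw [Finset.sum_mul, map_sum, map_sum]
  refine Finset.sum_congr rfl fun i _ => ?_
  rw [mul_assoc, hτ.map_mul, hφ, mul_comm a, mul_comm]

/-- A Frobenius trace composed with an automorphism over the base is a unit multiple of itself. -/
theorem IsFrobeniusTrace.exists_isUnit_twist {R S : Type*} [CommRing R] [CommRing S] {f : R →+* S}
    {τ : S →+ R} (hτ : IsFrobeniusTrace f τ) {g g' : S →+* S} (hgg' : ∀ a, g (g' a) = a)
    (hg'g : ∀ a, g' (g a) = a) (hg : ∀ r, g (f r) = f r) :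
    ∃ u, IsUnit u ∧ ∀ a, τ (g a) = τ (u * a) := by
  have hg' (r : R) : g' (f r) = f r := by rw [← hg r, hg'g, hg]
  obtain ⟨u, hu⟩ := hτ.exists_eq_mul (φ := τ.comp (g : S →+ S)) fun r s => by
    simp [hg, hτ.map_mul]
  obtain ⟨u', hu'⟩ := hτ.exists_eq_mul (φ := τ.comp (g' : S →+ S)) fun r s => by
    simp [hg', hτ.map_mul]
  simp only [AddMonoidHom.comp_apply, AddMonoidHom.coe_coe] at hu hu'
  have h : u' * g u - 1 = 0 := hτ.eq_zero fun a => by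
    rw [sub_mul, one_mul, map_sub, sub_eq_zero, mul_assoc, ← hu', _root_.map_mul, hg'g, ← hu, hgg']
  refine ⟨u, ?_, hu⟩
  have h' : IsUnit (g u) := IsUnit.of_mul_eq_one_right _ (sub_eq_zero.mp h)
  simpa [hg'g] using h'.map g'

section TriPoly

variable {p : ℕ}

/-- The constants of `TriPoly p`. -/
def triC : ZMod p →+* TriPoly p := algebraMap _ _

@[simp] theorem triPoly_hom_triC (f : TriPoly p →+* TriPoly p) (c : ZMod p) :
    f (triC c) = triC c :=
  triPoly_hom_algebraMap f c

/-- The linear substitution acting by `ζ` on `z` and by the matrix `M` on `x, y`. -/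
def triLin (ζ : ZMod p) (M : Matrix (Fin 2) (Fin 2) (ZMod p)) : TriPoly p →+* TriPoly p :=
  triSubst (triC ζ * triZ) (triC (M 0 0) * triX + triC (M 0 1) * triY)
    (triC (M 1 0) * triX + triC (M 1 1) * triY)

section

variable (ζ : ZMod p) (M : Matrix (Fin 2) (Fin 2) (ZMod p))

@[simp] theorem triLin_Z : triLin ζ M triZ = triC ζ * triZ := triSubst_Z _ _ _

@[simp] theorem triLin_X : triLin ζ M triX = triC (M 0 0) * triX + triC (M 0 1) * triY :=
  triSubst_X _ _ _

@[simp] theorem triLin_Y : triLin ζ M triY = triC (M 1 0) * triX + triC (M 1 1) * triY :=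
  triSubst_Y _ _ _

end

theorem triLin_triLin (ζ ζ' : ZMod p) (M N : Matrix (Fin 2) (Fin 2) (ZMod p)) (a : TriPoly p) :
    triLin ζ M (triLin ζ' N a) = triLin (ζ' * ζ) (N * M) a := by
  refine RingHom.congr_fun (f := (triLin ζ M).comp (triLin ζ' N)) (triPoly_hom_ext ?_ ?_ ?_) a
  · simp [mul_assoc]
  · simp [Matrix.mul_apply, Fin.sum_univ_two]
    ring
  · simp [Matrix.mul_apply, Fin.sum_univ_two]
    ring

theorem triLin_one (a : TriPoly p) : triLin 1 1 a = a :=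
  RingHom.congr_fun (g := RingHom.id _) (triPoly_hom_ext (by simp) (by simp) (by simp)) a

variable [Fact p.Prime]

theorem triC_injective : Function.Injective (triC (p := p)) :=
  FaithfulSMul.algebraMap_injective _ _

theorem triC_pow_card (c : ZMod p) : (triC c : TriPoly p) ^ p = triC c := by
  rw [← map_pow, ZMod.pow_card]

theorem triC_pow_card_sub_one {c : ZMod p} (hc : c ≠ 0) : (triC c : TriPoly p) ^ (p - 1) = 1 := by
  rw [← map_pow, ZMod.pow_card_sub_one_eq_one hc, map_one]

/-- The product `x y ^ p - x ^ p y` of linear forms, one for each line in the plane. -/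
def triL : TriPoly p := triX * triN

/-- The Dickson invariant of degree `p (p - 1)`. -/
def triD : TriPoly p := triN ^ (p - 1) + triX ^ (p * (p - 1))

theorem triL_eq : (triL : TriPoly p) = triX * triY ^ p - triX ^ p * triY := by
  have h : (triX : TriPoly p) ^ p = triX * triX ^ (p - 1) := by
    rw [← pow_succ', Nat.sub_add_cancel (Fact.out : p.Prime).one_le]
  rw [triL, triN, h]
  ring

theorem triD_mul_triL : (triD * triL : TriPoly p) =
    triX * triY ^ (p ^ 2) - triX ^ (p ^ 2) * triY := by
  have hN : (triN : TriPoly p) ^ p = triY ^ p ^ 2 - triX ^ (p * (p - 1)) * triY ^ p := by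
    rw [triN, sub_pow_char, mul_pow, ← pow_mul, ← pow_mul, sq, mul_comm (p - 1)]
  have hx : (triX : TriPoly p) ^ p ^ 2 = triX ^ (p * (p - 1)) * triX * triX ^ (p - 1) := by
    rw [mul_assoc, ← pow_succ', Nat.sub_add_cancel (Fact.out : p.Prime).one_le, ← pow_add,
      ← Nat.mul_succ, Nat.succ_eq_add_one, Nat.sub_add_cancel (Fact.out : p.Prime).one_le, sq]
  have hNs : (triN : TriPoly p) ^ p = triN ^ (p - 1) * triN := by
    rw [← pow_succ, Nat.sub_add_cancel (Fact.out : p.Prime).one_le]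
  calc (triD * triL : TriPoly p)
      = triX * (triN ^ (p - 1) * triN) + triX ^ (p * (p - 1)) * triX * triN := by
        rw [triD, triL]
        ring
    _ = _ := by
        rw [← hNs, hN, hx, triN]
        ring

theorem triN_ne_zero : (triN : TriPoly p) ≠ 0 := by
  rw [triN_eq]
  exact (monic_X_pow_sub_C_mul_X _ (Fact.out : p.Prime).one_lt).ne_zero

theorem triX_ne_zero : (triX : TriPoly p) ≠ 0 :=
  Polynomial.C_ne_zero.mpr Polynomial.X_ne_zero

theorem triL_ne_zero : (triL : TriPoly p) ≠ 0 := mul_ne_zero triX_ne_zero triN_ne_zero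

theorem triLin_triL (ζ : ZMod p) (M : Matrix (Fin 2) (Fin 2) (ZMod p)) :
    triLin ζ M triL = triC M.det * triL := by
  rw [triL_eq]
  simp [add_pow_char, mul_pow, triC_pow_card, Matrix.det_fin_two]
  ring

theorem triLin_triD (ζ : ZMod p) {M : Matrix (Fin 2) (Fin 2) (ZMod p)} (hM : M.det ≠ 0) :
    triLin ζ M triD = triD := by
  have h := congrArg (triLin ζ M) (triD_mul_triL (p := p))
  have h' : triLin ζ M (triX * triY ^ (p ^ 2) - triX ^ (p ^ 2) * triY) =
      triC M.det * (triX * triY ^ (p ^ 2) - triX ^ (p ^ 2) * triY) := by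
    simp [sq, pow_mul, add_pow_char, mul_pow, triC_pow_card, Matrix.det_fin_two]
    ring
  rw [h', ← triD_mul_triL, _root_.map_mul, triLin_triL] at h
  have hne : (triC M.det * triL : TriPoly p) ≠ 0 :=
    mul_ne_zero ((map_ne_zero_iff _ triC_injective).mpr hM) triL_ne_zero
  refine mul_right_cancel₀ hne (h.trans ?_)
  ring

/-- The extension to `z, x, y` of a matrix acting on `x, y` which makes the determinant `1`. -/
def triAct (M : Matrix (Fin 2) (Fin 2) (ZMod p)) : TriPoly p →+* TriPoly p := triLin M.det⁻¹ M

theorem triAct_triAct (M N : Matrix (Fin 2) (Fin 2) (ZMod p)) (a : TriPoly p) :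
    triAct M (triAct N a) = triAct (N * M) a := by
  rw [triAct, triAct, triAct, triLin_triLin, det_mul, mul_inv]

theorem triAct_one (a : TriPoly p) : triAct 1 a = a := by
  rw [triAct, det_one, inv_one, triLin_one]

theorem IsFrobeniusTrace.exists_triC_twist {f : TriPoly p →+* TriPoly p}
    {τ : TriPoly p →+ TriPoly p} (hτ : IsFrobeniusTrace f τ) {g g' : TriPoly p →+* TriPoly p}
    (hgg' : ∀ a, g (g' a) = a) (hg'g : ∀ a, g' (g a) = a) (hg : ∀ r, g (f r) = f r) :
    ∃ c : ZMod p, ∀ a, τ (g a) = triC c * τ a := by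
  obtain ⟨u, hu, h⟩ := hτ.exists_isUnit_twist hgg' hg'g hg
  obtain ⟨c, rfl⟩ := exists_algebraMap_of_isUnit hu
  refine ⟨c, fun a => (h a).trans ?_⟩
  have := hτ.map_mul (triC c) a
  rwa [triPoly_hom_triC] at this

theorem IsFrobeniusTrace.apply_eq_of_apply_top_eq {f : TriPoly p →+* TriPoly p}
    {τ : TriPoly p →+ TriPoly p} (hτ : IsFrobeniusTrace f τ) {g g' : TriPoly p →+* TriPoly p}
    (hgg' : ∀ a, g (g' a) = a) (hg'g : ∀ a, g' (g a) = a) (hg : ∀ r, g (f r) = f r)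
    {t : TriPoly p} (ht : τ t = 1) (hgt : g t = t) (a : TriPoly p) : τ (g a) = τ a := by
  obtain ⟨c, hc⟩ := hτ.exists_triC_twist hgg' hg'g hg
  have h := hc t
  rw [hgt, ht, mul_one] at h
  rw [hc, ← h, one_mul]

theorem triAct_inv {M N : Matrix (Fin 2) (Fin 2) (ZMod p)} (hMN : N * M = 1) (a : TriPoly p) :
    triAct M (triAct N a) = a := by
  rw [triAct_triAct, hMN, triAct_one]

/-- The inclusion of the polynomial ring on `z ^ (p - 1)` and the two Dickson invariants. -/
def dicksonMap : TriPoly p →+* TriPoly p :=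
  triSubst (triZ ^ (p - 1)) triD (-(triN ^ (p - 1) * triX ^ (p - 1)))

theorem triAct_dicksonMap {M : Matrix (Fin 2) (Fin 2) (ZMod p)} (hM : M.det ≠ 0)
    (a : TriPoly p) : triAct M (dicksonMap a) = dicksonMap a := by
  refine RingHom.congr_fun (f := (triAct M).comp dicksonMap) (triPoly_hom_ext ?_ ?_ ?_) a
  · simp [dicksonMap, triAct, mul_pow, -map_inv₀,
      triC_pow_card_sub_one (inv_ne_zero hM)]
  · simp [dicksonMap, triAct, triLin_triD _ hM]
  · have h : (-(triN ^ (p - 1) * triX ^ (p - 1)) : TriPoly p) = -triL ^ (p - 1) := by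
      rw [triL, mul_pow, mul_comm]
    simp [dicksonMap, triAct, h, triLin_triL, mul_pow, triC_pow_card_sub_one hM]

theorem triLin_triN (ζ : ZMod p) {M : Matrix (Fin 2) (Fin 2) (ZMod p)} (h : M 0 1 = 0)
    (h0 : M 0 0 ≠ 0) : triLin ζ M triN = triC (M 1 1) * triN := by
  have hx : (triX : TriPoly p) ^ p = triX ^ (p - 1) * triX := by
    rw [← pow_succ, Nat.sub_add_cancel (Fact.out : p.Prime).one_le]
  simp [triN, h, mul_pow, add_pow_char, triC_pow_card_sub_one h0, triC_pow_card, hx]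
  ring

theorem det_transvection_ne_zero {i j : Fin 2} (h : i ≠ j) (c : ZMod p) :
    (transvection i j c).det ≠ 0 := by
  rw [det_transvection_of_ne _ _ h]
  exact one_ne_zero

/-- The trace over the Dickson invariants is invariant under the twisted action. -/
theorem exists_dickson_trace : ∃ τ : TriPoly p →+ TriPoly p, IsFrobeniusTrace dicksonMap τ ∧
    ∀ M : Matrix (Fin 2) (Fin 2) (ZMod p), M.det ≠ 0 → ∀ a, τ (triAct M a) = τ a := by
  obtain ⟨τ, hτ, h1⟩ := hasFrobeniusTop_dickson (p := p)
  replace hτ : IsFrobeniusTrace dicksonMap τ := hτ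
  have hinv {M : Matrix (Fin 2) (Fin 2) (ZMod p)} (hM : M.det ≠ 0) : M⁻¹ * M = 1 ∧ M * M⁻¹ = 1 :=
    ⟨nonsing_inv_mul _ hM.isUnit, mul_nonsing_inv _ hM.isUnit⟩
  refine ⟨τ, hτ, fun M hM => diagonal_transvection_induction_of_det_ne_zero
    (fun M => ∀ a, τ (triAct M a) = τ a) M hM (fun D hD => ?_) (fun t => ?_)
    fun A B _ _ ihA ihB a => by rw [← triAct_triAct, ihB, ihA]⟩
  · have h0 : D 0 ≠ 0 := fun h => hD (by simp [h, Fin.prod_univ_two])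
    have hδ : D 1 ≠ 0 := fun h => hD (by simp [h, Fin.prod_univ_two])
    refine hτ.apply_eq_of_apply_top_eq (triAct_inv (hinv hD).1) (triAct_inv (hinv hD).2)
      (triAct_dicksonMap hD) h1 ?_
    have hz : triAct (diagonal D) triZ = triC (D 0 * D 1)⁻¹ * triZ := by
      simp [triAct, Fin.prod_univ_two]
    have hx : triAct (diagonal D) triX = triC (D 0) * triX := by simp [triAct]
    have hy : triAct (diagonal D) triY = triC (D 1) * triY := by simp [triAct]
    have hN : triAct (diagonal D) triN = triC (D 1) * triN :=
      (triLin_triN _ (by simp) (by simpa using h0)).trans (by rw [diagonal_apply_eq])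
    have hone : (triC (D 0 * D 1)⁻¹ * triC (D 0) * triC (D 1) : TriPoly p) ^ (p - 2) = 1 := by
      rw [← _root_.map_mul, ← _root_.map_mul, mul_assoc, inv_mul_cancel₀ (mul_ne_zero h0 hδ),
        map_one, one_pow]
    simp only [_root_.map_mul, map_pow, hz, hx, hy, hN, mul_pow, mul_comm p, pow_mul,
      triC_pow_card_sub_one h0, triC_pow_card_sub_one hδ, one_pow] at hone ⊢
    linear_combination (triZ ^ (p - 2) * (triX ^ (p - 1)) ^ p * triN ^ (p - 2) * triX ^ (p - 2) *
      triY ^ (p - 1)) * hone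
  · obtain ⟨i, j, hij, c⟩ := t
    have hdet := det_transvection_ne_zero (p := p) hij
    obtain ⟨χ, hχ⟩ := hτ.exists_triC_twist (triAct_inv (hinv (hdet c)).1)
      (triAct_inv (hinv (hdet c)).2) (triAct_dicksonMap (hdet c))
    have hpow (n : ℕ) (a : TriPoly p) :
        τ (triAct (transvection i j ((n : ZMod p) * c)) a) = triC χ ^ n * τ a := by
      induction n generalizing a with
      | zero => simp [triAct_one]
      | succ n ih =>
        rw [Nat.cast_succ, add_mul, one_mul, ← transvection_mul_transvection_same _ _ hij,
          ← triAct_triAct, hχ, ih, pow_succ]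
        ring
    have h := hpow p
    simp only [CharP.cast_eq_zero, zero_mul, transvection_zero, triAct_one, triC_pow_card] at h
    intro a
    rw [TransvectionStruct.toMatrix_mk, hχ, ← h]

/-- The invariants of a group of order prime to `p` are Gorenstein. -/
theorem isGorensteinImage_of_not_dvd_card (H : Subgroup (GL (Fin 2) (ZMod p)))
    (hH : ¬ p ∣ Nat.card H) : IsGorensteinImage {t : TriPoly p | ∀ h ∈ H, triAct h.1 t = t} := by
  obtain ⟨τ, hτ, h⟩ := exists_dickson_trace (p := p)
  have hdet (h : GL (Fin 2) (ZMod p)) : h.1.det ≠ 0 := h.det.ne_zero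
  have hcard : IsUnit (Nat.card H : TriPoly p) := by
    rw [← map_natCast triC]
    refine IsUnit.map triC (isUnit_iff_ne_zero.mpr fun h => hH ?_)
    rwa [ZMod.natCast_eq_zero_iff] at h
  have := hτ.isGorensteinImage_fixed 3 hasProjectiveDimensionLE_triPoly
    (fun h : H => triAct h.1.1) (fun a b x => (triAct_triAct _ _ x).symm) hcard
    (fun h => triAct_dicksonMap (hdet _)) (fun g => h _ (hdet _))
  simpa using this

end TriPoly

theorem HasFrobeniusTop.injective {R S : Type*} [CommRing R] [CommRing S] {f : R →+* S} {a : S}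
    (h : HasFrobeniusTop f a) : Function.Injective f := by
  obtain ⟨τ, hτ, hτa⟩ := h
  refine (injective_iff_map_eq_zero f).mpr fun r hr => ?_
  have := hτ.map_mul r a
  rwa [hr, zero_mul, map_zero, hτa, mul_one, eq_comm] at this

/-- A polynomial over a domain of characteristic `p` that is invariant under translation by
`x ≠ 0` is a polynomial in `X ^ p - x ^ (p - 1) X`. -/
theorem exists_comp_eq_of_comp_X_add_C {E : Type*} [CommRing E] [IsDomain E] {p : ℕ}
    [Fact p.Prime] [CharP E p] {x : E} (hx : x ≠ 0) (f : Polynomial E)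
    (hf : f.comp (Polynomial.X + Polynomial.C x) = f) :
    ∃ g : Polynomial E, g.comp (Polynomial.X ^ p -
      Polynomial.C (x ^ (p - 1)) * Polynomial.X) = f := by
  have hp := (Fact.out : p.Prime).one_lt
  set N : Polynomial E := Polynomial.X ^ p - Polynomial.C (x ^ (p - 1)) * Polynomial.X with hNdef
  have hN : N.Monic := monic_X_pow_sub_C_mul_X _ hp
  have hNd : N.natDegree = p := natDegree_X_pow_sub_C_mul_X _ hp
  have hNx : N.comp (Polynomial.X + Polynomial.C x) = N := by
    have h : x ^ p = x ^ (p - 1) * x := by rw [← pow_succ, Nat.sub_add_cancel hp.le]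
    simp only [hNdef, Polynomial.sub_comp, Polynomial.pow_comp, Polynomial.X_comp,
      Polynomial.mul_comp, Polynomial.C_comp]
    rw [add_pow_char, ← map_pow Polynomial.C x p, h, _root_.map_mul]
    ring
  induction hn : f.natDegree using Nat.strong_induction_on generalizing f with
  | _ n ih =>
    have hdiv := Polynomial.modByMonic_add_div f N
    have hrdeg : (f %ₘ N).degree < N.degree := Polynomial.degree_modByMonic_lt f hN
    have huniq := Polynomial.div_modByMonic_unique
      ((f /ₘ N).comp (Polynomial.X + Polynomial.C x))
      ((f %ₘ N).comp (Polynomial.X + Polynomial.C x)) hN (f := f) ⟨by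
        conv_rhs => rw [← hf, ← hdiv]
        rw [Polynomial.add_comp, Polynomial.mul_comp, hNx], by
        rwa [← Polynomial.taylor_apply, Polynomial.degree_taylor]⟩
    obtain ⟨hq, hr⟩ := huniq
    have hrC : f %ₘ N = Polynomial.C ((f %ₘ N).eval 0) := by
      have hev (k : ℕ) : (f %ₘ N).eval (k * x) = (f %ₘ N).eval 0 := by
        induction k with
        | zero => simp
        | succ k ihk =>
          rw [← ihk]
          conv_rhs => rw [hr]
          simp [add_mul]
      refine sub_eq_zero.mp (Polynomial.eq_zero_of_natDegree_lt_card_of_eval_eq_zero _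
        (f := fun k : Fin p => (k : E) * x) (fun i j hij => ?_) (fun i => ?_) ?_)
      · have h := mul_right_cancel₀ hx hij
        exact Fin.ext (CharP.natCast_injOn_Iio E p i.2 j.2 h)
      · simpa [sub_eq_zero] using hev i
      · rw [Polynomial.natDegree_sub_C, Fintype.card_fin]
        refine (Polynomial.natDegree_modByMonic_lt f hN fun h => ?_).trans_eq hNd
        rw [h, Polynomial.natDegree_one] at hNd
        omega
    by_cases hfp : f.natDegree < p
    · refine ⟨Polynomial.C ((f %ₘ N).eval 0), ?_⟩
      rw [Polynomial.C_comp, ← hrC]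
      refine (Polynomial.modByMonic_eq_self_iff hN).mpr (Polynomial.degree_lt_degree ?_)
      rwa [hNd]
    · obtain ⟨g, hg⟩ := ih (f /ₘ N).natDegree (by
        rw [Polynomial.natDegree_divByMonic f hN]
        omega) (f /ₘ N) hq.symm rfl
      refine ⟨Polynomial.C ((f %ₘ N).eval 0) + Polynomial.X * g, ?_⟩
      rw [Polynomial.add_comp, Polynomial.mul_comp, Polynomial.X_comp, hg, Polynomial.C_comp,
        ← hrC, hdiv]

section TriPoly

variable {p : ℕ} [Fact p.Prime]

theorem triAct_eq_of_mem_closure {S : Set (GL (Fin 2) (ZMod p))} {t : TriPoly p}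
    (h : ∀ s ∈ S, triAct s.1 t = t) : ∀ s ∈ Subgroup.closure S, triAct s.1 t = t := by
  intro s hs
  induction hs using Subgroup.closure_induction with
  | mem s hs => exact h s hs
  | one => exact triAct_one t
  | mul a b _ _ ha hb => rw [Units.val_mul, ← triAct_triAct, ha, hb]
  | inv a _ ha =>
    conv_lhs => rw [← ha]
    exact triAct_inv a.mul_inv t

theorem isGorensteinImage_diagonal (S : Set (Fin 2 → ZMod p)ˣ) :
    IsGorensteinImage {t : TriPoly p | ∀ s ∈ S, triAct (diagonal s.1) t = t} := by
  let φ : (Fin 2 → ZMod p)ˣ →* GL (Fin 2) (ZMod p) :=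
    Units.map (Matrix.diagonalRingHom (Fin 2) (ZMod p)).toMonoidHom
  have hφ (s) : (φ s).1 = diagonal s.1 := rfl
  have h := isGorensteinImage_of_not_dvd_card ((Subgroup.closure S).map φ) fun hdvd => by
    obtain ⟨g, hg⟩ := exists_prime_orderOf_dvd_card' p hdvd
    obtain ⟨s, -, hsg⟩ := g.2
    have hs : s ^ (p - 1) = 1 := Units.ext (funext fun i => by
      simpa using ZMod.pow_card_sub_one_eq_one
        (show s.1 i ≠ 0 from fun h => by simpa [h] using congrFun s.mul_inv i))
    have := orderOf_dvd_of_pow_eq_one (x := φ s) (n := p - 1) (by rw [← map_pow, hs, map_one])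
    rw [← Subgroup.orderOf_coe, ← hsg] at hg
    rw [hg] at this
    have := Nat.le_of_dvd (Nat.sub_pos_of_lt (Fact.out : p.Prime).one_lt) this
    have := (Fact.out : p.Prime).one_lt
    omega
  rw [MonoidHom.map_closure] at h
  convert h using 1
  ext t
  refine ⟨fun h => triAct_eq_of_mem_closure ?_, fun h s hs =>
    h (φ s) (Subgroup.subset_closure ⟨s, hs, rfl⟩)⟩
  rintro _ ⟨s, hs, rfl⟩
  exact h s hs

theorem triSubst_triZ_triX (q f : TriPoly p) : triSubst triZ triX q f =
    Polynomial.comp (R := Polynomial (Polynomial (ZMod p))) f q := by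
  refine RingHom.congr_fun (g := (Polynomial.compRingHom q :
    Polynomial (Polynomial (Polynomial (ZMod p))) →+*
      Polynomial (Polynomial (Polynomial (ZMod p))))) (triPoly_hom_ext ?_ ?_ ?_) f
  · exact (triSubst_Z _ _ _).trans (Polynomial.C_comp (R := Polynomial (Polynomial (ZMod p)))).symm
  · exact (triSubst_X _ _ _).trans (Polynomial.C_comp (R := Polynomial (Polynomial (ZMod p)))).symm
  · exact (triSubst_Y _ _ _).trans (Polynomial.X_comp (R := Polynomial (Polynomial (ZMod p)))).symm

theorem triAct_transvection_one (f : TriPoly p) : triAct (transvection 1 0 1) f =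
    triSubst triZ triX (triY + triX) f := by
  refine RingHom.congr_fun (triPoly_hom_ext ?_ ?_ ?_) f
  · simp [triAct, det_transvection_of_ne]
  · simp [triAct, transvection]
  · simp [triAct, transvection, add_comm]

theorem exists_triSubst_triN_eq {f : TriPoly p} (hf : triAct (transvection 1 0 1) f = f) :
    ∃ g : TriPoly p, triSubst triZ triX triN g = f := by
  rw [triAct_transvection_one, triSubst_triZ_triX] at hf
  obtain ⟨g, hg⟩ := exists_comp_eq_of_comp_X_add_C Polynomial.X_ne_zero f hf
  refine ⟨g, (triSubst_triZ_triX _ _).trans ?_⟩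
  rwa [triN_eq]

theorem det_ne_zero_of_GL (h : GL (Fin 2) (ZMod p)) : h.1.det ≠ 0 :=
  (h.1.isUnit_iff_isUnit_det.mp h.isUnit).ne_zero

theorem isGorensteinImage_of_lowerTriangular {H : Subgroup (GL (Fin 2) (ZMod p))}
    (hU : ∃ h ∈ H, h.1 = transvection 1 0 1) (hH : ∀ h ∈ H, h.1 0 1 = 0) :
    IsGorensteinImage {t : TriPoly p | ∀ h ∈ H, triAct h.1 t = t} := by
  refine .of_preimage (triSubst triZ triX triN) hasFrobeniusTop_triN.injective
    (fun t ht => ?_) ?_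
  · obtain ⟨h, hh, hhU⟩ := hU
    exact exists_triSubst_triN_eq (hhU ▸ ht h hh)
  convert isGorensteinImage_diagonal {s : (Fin 2 → ZMod p)ˣ | ∃ h ∈ H, s.1 = ![h.1 0 0, h.1 1 1]}
    using 1
  have hdet {h} (hh : h ∈ H) : h.1.det = h.1 0 0 * h.1 1 1 := by
    simp [det_fin_two, hH h hh]
  have hcomm {h} (hh : h ∈ H) (t : TriPoly p) : triAct h.1 (triSubst triZ triX triN t) =
      triSubst triZ triX triN (triAct (diagonal ![h.1 0 0, h.1 1 1]) t) := by
    have h0 := left_ne_zero_of_mul (hdet hh ▸ det_ne_zero_of_GL h)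
    refine RingHom.congr_fun (f := (triAct h.1).comp (triSubst triZ triX triN))
      (g := (triSubst triZ triX triN).comp (triAct _)) (triPoly_hom_ext ?_ ?_ ?_) t
    · simp [triAct, hdet hh, -map_inv₀]
    · simp [triAct, hH h hh]
    · simp [triAct, triLin_triN _ (hH h hh) h0]
  ext t
  simp only [Set.mem_preimage, Set.mem_ofPred_eq]
  constructor
  · rintro ht s ⟨h, hh, hs⟩
    rw [hs]
    exact hasFrobeniusTop_triN.injective ((hcomm hh t).symm.trans (ht h hh))
  · intro ht h hh
    have h0 := hdet hh ▸ det_ne_zero_of_GL h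
    exact (hcomm hh t).trans (congrArg _ <| ht (Pi.isUnit_iff (x := ![h.1 0 0, h.1 1 1]).mpr (by
      simpa [Fin.forall_fin_two] using mul_ne_zero_iff.mp h0)).unit ⟨h, hh, rfl⟩)

theorem isGorensteinImage_of_conj {H : Subgroup (GL (Fin 2) (ZMod p))} (k : GL (Fin 2) (ZMod p))
    (h : IsGorensteinImage {t : TriPoly p | ∀ h ∈ H.map (MulAut.conj k).toMonoidHom,
      triAct h.1 t = t}) : IsGorensteinImage {t : TriPoly p | ∀ h ∈ H, triAct h.1 t = t} := by
  have hk : Function.LeftInverse (triAct k.1) (triAct (k⁻¹).1) := triAct_inv k.inv_mul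
  have hk' : Function.LeftInverse (triAct (k⁻¹).1) (triAct k.1) := triAct_inv k.mul_inv
  refine .of_preimage (triAct k.1) hk'.injective (fun t _ => ⟨triAct (k⁻¹).1 t, hk t⟩) ?_
  convert h using 1
  ext t
  have key (h : GL (Fin 2) (ZMod p)) : triAct h.1 (triAct k.1 t) = triAct k.1 t ↔
      triAct (k * h * k⁻¹).1 t = t := by
    rw [← hk.injective.eq_iff, hk', triAct_triAct, triAct_triAct, mul_assoc, Units.val_mul,
      Units.val_mul]
  refine ⟨?_, fun ht h hh => (key h).mpr (ht _ ⟨h, hh, rfl⟩)⟩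
  rintro ht _ ⟨h, hh, rfl⟩
  exact (key h).mp (ht h hh)

end TriPoly

section TriPoly

variable {p : ℕ}

theorem dvd_sub_of_dvd_sub_vars {f : TriPoly p →+* TriPoly p} {r : TriPoly p}
    (hz : r ∣ triZ - f triZ) (hx : r ∣ triX - f triX) (hy : r ∣ triY - f triY) (t : TriPoly p) :
    r ∣ t - f t := by
  have h {a b : TriPoly p} : r ∣ a - b ↔ Ideal.Quotient.mk (Ideal.span {r}) a =
      Ideal.Quotient.mk (Ideal.span {r}) b := by
    rw [Ideal.Quotient.eq, Ideal.mem_span_singleton]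
  rw [h] at *
  exact RingHom.congr_fun (g := (Ideal.Quotient.mk (Ideal.span {r})).comp f)
    (triPoly_hom_ext hz hx hy) t

theorem triX_dvd_of_triSubst_eq_zero {t : TriPoly p}
    (h : triSubst triZ 0 triY t = (0 : TriPoly p)) :
    triX ∣ t := by
  simpa [h] using dvd_sub_of_dvd_sub_vars (f := triSubst triZ 0 triY) (r := triX)
    (by simp) (by simp) (by simp) t

theorem triY_dvd_of_triSubst_eq_zero {t : TriPoly p}
    (h : triSubst triZ triX 0 t = (0 : TriPoly p)) :
    triY ∣ t := by
  simpa [h] using dvd_sub_of_dvd_sub_vars (f := triSubst triZ triX 0) (r := triY)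
    (by simp) (by simp) (by simp) t

theorem triSubst_triZ_coeff (b c : TriPoly p) (q : Polynomial (Polynomial (ZMod p))) :
    triSubst triZ b c (triCoeff q) =
      Polynomial.comp (R := Polynomial (Polynomial (ZMod p))) (q.map Polynomial.C) b := by
  rw [triSubst_coeff]
  refine .trans ?_ (Polynomial.eval₂_map _ _ _).symm
  congr 1
  exact Polynomial.ringHom_ext' (Subsingleton.elim _ _) (by simp [triZ]; rfl)

/-- Setting the second variable to zero. -/
def triRestrict : TriPoly p →+* Polynomial (Polynomial (ZMod p)) :=
  (Polynomial.mapRingHom (Polynomial.evalRingHom 0) :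
    Polynomial (Polynomial (Polynomial (ZMod p))) →+* _)

@[simp] theorem triRestrict_Z : triRestrict (triZ : TriPoly p) = Polynomial.C Polynomial.X :=
  (Polynomial.map_C (R := Polynomial (Polynomial (ZMod p))) _).trans (by simp)

@[simp] theorem triRestrict_X : triRestrict (triX : TriPoly p) = 0 :=
  (Polynomial.map_C (R := Polynomial (Polynomial (ZMod p))) _).trans (by simp)

@[simp] theorem triRestrict_Y : triRestrict (triY : TriPoly p) = Polynomial.X :=
  Polynomial.map_X (R := Polynomial (Polynomial (ZMod p))) _

@[simp] theorem triRestrict_C (c : ZMod p) : triRestrict (triC c : TriPoly p) =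
    Polynomial.C (Polynomial.C c) :=
  (Polynomial.map_C (R := Polynomial (Polynomial (ZMod p))) _).trans (by simp)

theorem triSubst_triZ_zero (b t : TriPoly p) :
    triSubst triZ 0 b t = triSubst triZ b 0 (triCoeff (triRestrict t)) := by
  refine RingHom.congr_fun (g := (triSubst triZ b 0).comp (triCoeff.comp triRestrict))
    (triPoly_hom_ext ?_ ?_ ?_) t
  · rw [RingHom.comp_apply, RingHom.comp_apply, triRestrict_Z, triSubst_Z]
    exact (triSubst_Z _ _ _).symm
  · simp
  · rw [RingHom.comp_apply, RingHom.comp_apply, triRestrict_Y, triSubst_Y]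
    exact (triSubst_X _ _ _).symm

theorem triSubst_coeff_expand (n : ℕ) (b c : TriPoly p) (q : Polynomial (Polynomial (ZMod p))) :
    triSubst triZ b c (triCoeff (Polynomial.expand _ n q)) =
      triSubst triZ (b ^ n) c (triCoeff q) := by
  simp [triSubst_coeff, Polynomial.expand_eq_comp_X_pow, Polynomial.eval₂_comp]

variable [Fact p.Prime]

theorem natDegree_triN : Polynomial.natDegree
    (R := Polynomial (Polynomial (ZMod p))) (triN (p := p)) = p := by
  rw [triN_eq]
  exact natDegree_X_pow_sub_C_mul_X _ (Fact.out : p.Prime).one_lt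

theorem natDegree_triL : Polynomial.natDegree
    (R := Polynomial (Polynomial (ZMod p))) (triL (p := p)) = p :=
  (Polynomial.natDegree_mul triX_ne_zero triN_ne_zero).trans (by
    rw [natDegree_triN]
    exact (congrArg (· + p) (Polynomial.natDegree_C _)).trans (zero_add p))

theorem natDegree_triD_le : Polynomial.natDegree
    (R := Polynomial (Polynomial (ZMod p))) (triD (p := p)) ≤ p * (p - 1) := by
  refine Polynomial.natDegree_add_le_of_degree_le ?_ ?_
  · refine Polynomial.natDegree_pow_le.trans ?_
    rw [natDegree_triN, mul_comm]
  · refine Polynomial.natDegree_pow_le.trans ?_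
    refine (congrArg (_ * ·) (Polynomial.natDegree_C _)).le.trans ?_
    simp

/-- The inclusion of the polynomial ring on `z` and the invariants of `SL₂`. -/
def specialMap : TriPoly p →+* TriPoly p := triSubst triZ triD triL

theorem triAct_specialMap {M : Matrix (Fin 2) (Fin 2) (ZMod p)} (hM : M.det ≠ 0) (t : TriPoly p) :
    triAct M (specialMap t) = specialMap (triAct (diagonal ![1, M.det]) t) := by
  refine RingHom.congr_fun (f := (triAct M).comp specialMap)
    (g := specialMap.comp (triAct _)) (triPoly_hom_ext ?_ ?_ ?_) t
  · simp [specialMap, triAct, -map_inv₀]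
  · simp [specialMap, triAct, triLin_triD _ hM]
  · simp [specialMap, triAct, triLin_triL]

theorem triAct_specialMap_of_det_eq_one {M : Matrix (Fin 2) (Fin 2) (ZMod p)} (hM : M.det = 1)
    (t : TriPoly p) : triAct M (specialMap t) = specialMap t := by
  have h : (![1, M.det] : Fin 2 → ZMod p) = 1 := by
    ext i
    fin_cases i <;> simp [hM]
  rw [triAct_specialMap (hM ▸ one_ne_zero), h, diagonal_one', triAct_one]

end TriPoly

theorem Polynomial.exists_eq_mul_X_add_C {R : Type*} [CommRing R] (f : Polynomial R) :
    ∃ (g : Polynomial R) (r : R), (g ≠ 0 → g.natDegree < f.natDegree) ∧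
      f = g * Polynomial.X + Polynomial.C r := by
  refine ⟨f.divX, f.coeff 0, fun hg => ?_, f.divX_mul_X_add.symm⟩
  rw [Polynomial.natDegree_divX_eq_natDegree_tsub_one]
  refine Nat.sub_lt (Nat.pos_of_ne_zero fun h0 => hg ?_) one_pos
  exact f.divX_eq_zero_iff.mpr (Polynomial.eq_C_of_natDegree_eq_zero h0)

section TriPoly

variable {p : ℕ} [Fact p.Prime]

theorem exists_eq_mul_triY_add (t : TriPoly p) :
    ∃ (s : TriPoly p) (q : Polynomial (Polynomial (ZMod p))),
      (s ≠ 0 → Polynomial.natDegree (R := Polynomial (Polynomial (ZMod p))) s <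
        Polynomial.natDegree (R := Polynomial (Polynomial (ZMod p))) t) ∧
      t = s * triY (p := p) + triCoeff (p := p) q :=
  Polynomial.exists_eq_mul_X_add_C (R := Polynomial (Polynomial (ZMod p))) t

theorem triSubst_specialMap (t : TriPoly p) : triSubst triZ 0 triY (specialMap t) =
    (triSubst triZ (triY ^ (p * (p - 1))) 0 t : TriPoly p) := by
  have hp := (Fact.out : p.Prime).one_lt
  have hN : triSubst triZ 0 triY (triN (p := p)) = (triY ^ p : TriPoly p) := by
    simp [triN, (Nat.sub_pos_of_lt hp).ne']
  refine RingHom.congr_fun (f := (triSubst triZ 0 triY).comp specialMap)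
    (triPoly_hom_ext ?_ ?_ ?_) t
  · simp [specialMap]
  · simp [specialMap, triD, hN, (Nat.sub_pos_of_lt hp).ne', (Fact.out : p.Prime).ne_zero, pow_mul]
  · simp [specialMap, triL]

theorem specialMap_injective : Function.Injective (specialMap (p := p)) := by
  have hp := (Fact.out : p.Prime).one_lt
  refine (injective_iff_map_eq_zero _).mpr fun t ht => ?_
  induction hn : Polynomial.natDegree (R := Polynomial (Polynomial (ZMod p))) t
    using Nat.strong_induction_on generalizing t with
  | _ n ih =>
    obtain ⟨s, q, hs, hts⟩ := exists_eq_mul_triY_add t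
    rw [hn] at hs
    have hq : q = 0 := by
      have h := triSubst_specialMap t
      rw [ht, map_zero, hts, map_add, _root_.map_mul, triSubst_Y, mul_zero, zero_add,
        ← triSubst_coeff_expand, triSubst_triZ_coeff] at h
      have h' := (Polynomial.comp_X (R := Polynomial (Polynomial (ZMod p)))).symm.trans h.symm
      exact (Polynomial.expand_eq_zero (Nat.mul_pos (by omega) (by omega))).mp
        ((Polynomial.map_eq_zero_iff Polynomial.C_injective).mp h')
    rw [hq, map_zero, add_zero] at hts
    by_cases hs0 : s = 0
    · rw [hts, hs0, zero_mul]
    rw [hts, ih _ (hs hs0) s ?_ rfl, zero_mul]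
    rw [hts, _root_.map_mul] at ht
    exact (mul_eq_zero.mp ht).resolve_right ((triSubst_Y _ _ _).trans_ne triL_ne_zero)

theorem card_sub_one_dvd_of_forall_pow_eq_one {n : ℕ} (h : ∀ a : ZMod p, a ≠ 0 → a ^ n = 1) :
    p - 1 ∣ n := by
  rw [← ZMod.card p, ← FiniteField.forall_pow_eq_one_iff]
  exact fun a => Units.ext (by simpa using h a.1 a.ne_zero)

/-- The restriction to `x = 0` of an invariant of the diagonal matrices of determinant `1` is a
polynomial in `y ^ (p - 1)`. -/
theorem exists_expand_eq_triRestrict {t : TriPoly p}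
    (ht : ∀ a : ZMod p, a ≠ 0 → triAct (diagonal ![a⁻¹, a]) t = t) :
    ∃ q, Polynomial.expand _ (p - 1) q = triRestrict t := by
  have hp := (Fact.out : p.Prime).one_lt
  refine ⟨Polynomial.contract (p - 1) (triRestrict t), ?_⟩
  have hcoeff (n : ℕ) (hn : (triRestrict t).coeff n ≠ 0) : p - 1 ∣ n := by
    refine card_sub_one_dvd_of_forall_pow_eq_one fun a ha => ?_
    have hcomm (s : TriPoly p) : triRestrict (triAct (diagonal ![a⁻¹, a]) s) =
        (triRestrict s).comp (Polynomial.C (Polynomial.C a) * Polynomial.X) := by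
      refine RingHom.congr_fun (f := triRestrict.comp (triAct _))
        (g := (Polynomial.compRingHom _).comp triRestrict) (triPoly_hom_ext ?_ ?_ ?_) s
      · simp [triAct, ha]
      · simp [triAct]
      · simp [triAct]
    have h := congrArg (Polynomial.coeff · n) (hcomm t)
    simp only [ht a ha, Polynomial.comp_C_mul_X_coeff] at h
    have h' := mul_left_cancel₀ hn ((mul_one _).trans h)
    rw [← map_pow, ← map_one Polynomial.C] at h'
    exact (Polynomial.C_injective h').symm
  ext1 n
  rw [Polynomial.coeff_expand (Nat.sub_pos_of_lt hp)]
  split_ifs with h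
  · rw [Polynomial.coeff_contract (Nat.sub_pos_of_lt hp).ne', Nat.div_mul_cancel h]
  · exact (not_not.mp (mt (hcoeff n) h)).symm

theorem diagonal_eq_transvection_mul {K : Type*} [Field K] {a : K} (ha : a ≠ 0) :
    diagonal ![a⁻¹, a] = transvection 1 0 (-a) * transvection (0 : Fin 2) 1 (a⁻¹ - 1) *
      transvection 1 0 1 * transvection 0 1 (a - 1) := by
  ext i j
  fin_cases i <;> fin_cases j <;>
    simp [transvection, Matrix.mul_apply, Fin.sum_univ_two] <;> field_simp <;> ring

theorem weyl_eq_transvection_mul {K : Type*} [Field K] :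
    !![0, 1; -1, 0] = transvection (0 : Fin 2) 1 (1 : K) * transvection 1 0 (-1) *
      transvection 0 1 1 := by
  ext i j
  fin_cases i <;> fin_cases j <;> simp [transvection, Matrix.mul_apply, Fin.sum_univ_two]

theorem natDegree_specialMap_coeff_le (q : Polynomial (Polynomial (ZMod p))) :
    Polynomial.natDegree (R := Polynomial (Polynomial (ZMod p))) (specialMap (triCoeff q)) ≤
      q.natDegree * (p * (p - 1)) := by
  rw [specialMap, triSubst_triZ_coeff]
  refine Polynomial.natDegree_comp_le.trans (Nat.mul_le_mul ?_ natDegree_triD_le)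
  exact Polynomial.natDegree_map_le

theorem natDegree_triRestrict_le (t : TriPoly p) : (triRestrict t).natDegree ≤
    Polynomial.natDegree (R := Polynomial (Polynomial (ZMod p))) t :=
  Polynomial.natDegree_map_le

theorem natDegree_triSubst_triN (t : TriPoly p) :
    Polynomial.natDegree (R := Polynomial (Polynomial (ZMod p))) (triSubst triZ triX triN t) =
      Polynomial.natDegree (R := Polynomial (Polynomial (ZMod p))) t * p := by
  rw [triSubst_triZ_triX]
  refine Polynomial.natDegree_comp.trans ?_
  rw [natDegree_triN]

theorem triAct_mul_eq {M N : Matrix (Fin 2) (Fin 2) (ZMod p)} {t : TriPoly p}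
    (hM : triAct M t = t) (hN : triAct N t = t) : triAct (M * N) t = t := by
  rw [← triAct_triAct, hM, hN]

theorem triAct_diagonal_triSubst_triN {a : ZMod p} (ha : a ≠ 0) (t : TriPoly p) :
    triAct (diagonal ![a⁻¹, a]) (triSubst triZ triX triN t) =
      triSubst triZ triX triN (triAct (diagonal ![a⁻¹, a]) t) := by
  refine RingHom.congr_fun (f := (triAct _).comp (triSubst triZ triX triN))
    (g := (triSubst triZ triX triN).comp (triAct _)) (triPoly_hom_ext ?_ ?_ ?_) t
  · simp [triAct, ha]
  · simp [triAct]
  · simp [triAct, triLin_triN _ (M := diagonal ![a⁻¹, a]) (by simp) (by simpa using ha)]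

/-- An invariant of the special linear group that vanishes on the line `x = 0` is divisible by
the product of all linear forms. -/
theorem triL_dvd_of_triSubst_eq_zero {t : TriPoly p}
    (ht : ∀ i j : Fin 2, i ≠ j → ∀ c, triAct (transvection i j c) t = t)
    (h0 : triSubst triZ 0 triY t = (0 : TriPoly p)) : triL ∣ t := by
  have hp := (Fact.out : p.Prime).one_lt
  have hw : triAct !![0, 1; -1, 0] t = t := by
    rw [weyl_eq_transvection_mul]
    exact triAct_mul_eq (triAct_mul_eq (ht 0 1 (by decide) _) (ht 1 0 (by decide) _))
      (ht 0 1 (by decide) _)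
  have h1 : triSubst triZ triX 0 t = (0 : TriPoly p) := by
    have h (s : TriPoly p) : (triSubst triZ triX 0 (triAct !![0, 1; -1, 0] s) : TriPoly p) =
        triSubst triZ 0 (-triX) (triSubst triZ 0 (triY (p := p)) s : TriPoly p) := by
      refine RingHom.congr_fun (f := (triSubst triZ triX 0).comp (triAct _))
        (g := (triSubst triZ 0 (-triX)).comp (triSubst triZ 0 triY)) (triPoly_hom_ext ?_ ?_ ?_) s
      · simp [triAct]
      · simp [triAct]
      · simp [triAct]
    rw [← hw, h, h0, map_zero]
  obtain ⟨F, rfl⟩ := exists_triSubst_triN_eq (ht 1 0 (by decide) 1)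
  obtain ⟨F', rfl⟩ : triY ∣ F := by
    refine triY_dvd_of_triSubst_eq_zero (.trans ?_ h1)
    refine RingHom.congr_fun (g := (triSubst triZ triX 0).comp (triSubst triZ triX triN))
      (triPoly_hom_ext ?_ ?_ ?_) F
    · simp
    · simp
    · simp [triN, (Fact.out : p.Prime).ne_zero]
  rw [_root_.map_mul, triSubst_Y] at h0 ⊢
  rw [_root_.map_mul] at h0
  rw [triL, mul_comm]
  refine mul_dvd_mul_left _ (triX_dvd_of_triSubst_eq_zero ((mul_eq_zero.mp h0).resolve_left ?_))
  have hY : (triY : TriPoly p) ≠ 0 :=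
    Polynomial.X_ne_zero (R := Polynomial (Polynomial (ZMod p)))
  simp [triN, (Nat.sub_pos_of_lt hp).ne', hY]

theorem exists_specialMap_coeff {t : TriPoly p}
    (ht : ∀ i j : Fin 2, i ≠ j → ∀ c, triAct (transvection i j c) t = t) :
    ∃ q : Polynomial (Polynomial (ZMod p)),
      Polynomial.natDegree (R := Polynomial (Polynomial (ZMod p))) (specialMap (triCoeff q)) ≤
        Polynomial.natDegree (R := Polynomial (Polynomial (ZMod p))) t ∧
      triSubst triZ 0 triY (specialMap (triCoeff q)) = (triSubst triZ 0 triY t : TriPoly p) := by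
  have hp := (Fact.out : p.Prime).one_lt
  obtain ⟨F, rfl⟩ := exists_triSubst_triN_eq (ht 1 0 (by decide) 1)
  obtain ⟨q, hq⟩ := exists_expand_eq_triRestrict (t := F) fun a ha => by
    apply hasFrobeniusTop_triN.injective
    rw [← triAct_diagonal_triSubst_triN ha, diagonal_eq_transvection_mul ha]
    exact triAct_mul_eq (triAct_mul_eq (triAct_mul_eq (ht 1 0 (by decide) _)
      (ht 0 1 (by decide) _)) (ht 1 0 (by decide) _)) (ht 0 1 (by decide) _)
  refine ⟨q, (natDegree_specialMap_coeff_le q).trans ?_, ?_⟩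
  · have h := natDegree_triRestrict_le F
    rw [← hq, Polynomial.natDegree_expand] at h
    rw [natDegree_triSubst_triN, mul_comm p, ← mul_assoc]
    exact Nat.mul_le_mul_right p h
  · rw [triSubst_specialMap, pow_mul, ← triSubst_coeff_expand, hq, ← triSubst_triZ_zero]
    refine RingHom.congr_fun (g := (triSubst triZ 0 triY).comp (triSubst triZ triX triN))
      (triPoly_hom_ext ?_ ?_ ?_) F
    · simp
    · simp
    · simp [triN, (Nat.sub_pos_of_lt hp).ne']

theorem exists_specialMap_eq {t : TriPoly p}
    (ht : ∀ i j : Fin 2, i ≠ j → ∀ c, triAct (transvection i j c) t = t) :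
    ∃ s, specialMap s = t := by
  induction hn : Polynomial.natDegree (R := Polynomial (Polynomial (ZMod p))) t
    using Nat.strong_induction_on generalizing t with
  | _ n ih =>
    obtain ⟨q, hdeg, hq⟩ := exists_specialMap_coeff ht
    have hdet (i j : Fin 2) (hij : i ≠ j) (c : ZMod p) : (transvection i j c).det = 1 :=
      det_transvection_of_ne _ _ hij c
    have hinv (i j : Fin 2) (hij : i ≠ j) (c : ZMod p) :
        triAct (transvection i j c) (t - specialMap (triCoeff q)) =
          t - specialMap (triCoeff q) := by
      rw [map_sub, ht i j hij, triAct_specialMap_of_det_eq_one (hdet i j hij c)]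
    obtain ⟨r, hr⟩ := triL_dvd_of_triSubst_eq_zero hinv (by rw [map_sub, hq, sub_self])
    obtain ⟨s, hs⟩ : ∃ s, specialMap s = r := by
      by_cases hr0 : r = 0
      · exact ⟨0, by rw [hr0, map_zero]⟩
      refine ih (Polynomial.natDegree (R := Polynomial (Polynomial (ZMod p))) r) ?_
        (fun i j hij c => ?_) rfl
      · have h := Polynomial.natDegree_sub_le_of_le (R := Polynomial (Polynomial (ZMod p)))
          hn.le (hdeg.trans hn.le)
        have h' : Polynomial.natDegree (R := Polynomial (Polynomial (ZMod p))) (triL * r) = _ :=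
          Polynomial.natDegree_mul triL_ne_zero hr0
        rw [natDegree_triL] at h'
        have hp := (Fact.out : p.Prime).pos
        rw [max_self] at h
        replace h := (congrArg (Polynomial.natDegree
          (R := Polynomial (Polynomial (ZMod p)))) hr).symm.le.trans h
        omega
      · have h := hinv i j hij c
        rw [hr, _root_.map_mul] at h
        refine mul_left_cancel₀ triL_ne_zero (.trans (congrArg (· * _) ?_) h)
        rw [triAct, triLin_triL, hdet i j hij, map_one, one_mul]
    refine ⟨triCoeff q + triY * s, ?_⟩
    rw [map_add, _root_.map_mul, hs]
    refine (sub_eq_iff_eq_add'.mp (hr.trans ?_)).symm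
    exact congrArg (· * r) (triSubst_Y _ _ _).symm

theorem isGorensteinImage_of_transvection_mem {H : Subgroup (GL (Fin 2) (ZMod p))}
    (hH : ∀ i j : Fin 2, i ≠ j → ∀ c, ∃ h ∈ H, h.1 = transvection i j c) :
    IsGorensteinImage {t : TriPoly p | ∀ h ∈ H, triAct h.1 t = t} := by
  refine .of_preimage specialMap specialMap_injective
    (fun t ht => exists_specialMap_eq fun i j hij c => ?_) ?_
  · obtain ⟨h, hh, hhU⟩ := hH i j hij c
    exact hhU ▸ ht h hh
  convert isGorensteinImage_diagonal {s : (Fin 2 → ZMod p)ˣ | ∃ h ∈ H, s.1 = ![1, h.1.det]}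
    using 1
  ext t
  simp only [Set.mem_preimage, Set.mem_ofPred_eq]
  constructor
  · rintro ht s ⟨h, hh, hs⟩
    rw [hs]
    exact specialMap_injective ((triAct_specialMap (det_ne_zero_of_GL h) t).symm.trans (ht h hh))
  · intro ht h hh
    exact (triAct_specialMap (det_ne_zero_of_GL h) t).trans (congrArg _ <|
      ht (Pi.isUnit_iff (x := ![1, h.1.det]).mpr (by
        simp [Fin.forall_fin_two, -GeneralLinearGroup.val_det_apply, det_ne_zero_of_GL])).unit
        ⟨h, hh, rfl⟩)

end TriPoly

theorem transvection_pow {n K : Type*} [Fintype n] [DecidableEq n] [CommRing K] {i j : n}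
    (hij : i ≠ j) (c : K) (m : ℕ) : transvection i j c ^ m = transvection i j (m * c) := by
  induction m with
  | zero => simp
  | succ m ih =>
    rw [pow_succ, ih, transvection_mul_transvection_same _ _ hij]
    congr 1
    push_cast
    ring

theorem conj_val_eq {n K : Type*} [Fintype n] [DecidableEq n] [CommRing K] {g k : GL n K}
    {M : Matrix n n K} (h : k.1 * g.1 = M * k.1) : (MulAut.conj k g).1 = M := by
  rw [MulAut.conj_apply, Units.val_mul, Units.val_mul, h, mul_assoc, Units.mul_inv, mul_one]

section TriPoly

variable {p : ℕ} [Fact p.Prime]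

theorem exists_mem_eq_transvection {H : Subgroup (GL (Fin 2) (ZMod p))} {i j : Fin 2}
    (hij : i ≠ j) {c : ZMod p} (hc : c ≠ 0) (h : ∃ h ∈ H, h.1 = transvection i j c) (d : ZMod p) :
    ∃ h ∈ H, h.1 = transvection i j d := by
  obtain ⟨h, hh, hhc⟩ := h
  refine ⟨h ^ (d / c).val, H.pow_mem hh _, ?_⟩
  rw [Units.val_pow_eq_pow_val, hhc, transvection_pow hij, ZMod.natCast_zmod_val,
    div_mul_cancel₀ d hc]

theorem isGorensteinImage_of_transvection_one_mem {H : Subgroup (GL (Fin 2) (ZMod p))}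
    (hU : ∃ h ∈ H, h.1 = transvection 1 0 1) :
    IsGorensteinImage {t : TriPoly p | ∀ h ∈ H, triAct h.1 t = t} := by
  by_cases hH : ∀ h ∈ H, h.1 0 1 = 0
  · exact isGorensteinImage_of_lowerTriangular hU hH
  push Not at hH
  obtain ⟨h, hh, hb⟩ := hH
  obtain ⟨u, hu, huU⟩ := hU
  let k : GL (Fin 2) (ZMod p) := GeneralLinearGroup.mkOfDetNeZero !![h.1 0 0, h.1 0 1; 1, 0]
    (by simpa [det_fin_two] using hb)
  have hk : k.1 = !![h.1 0 0, h.1 0 1; 1, 0] := rfl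
  have hinv := congrFun (congrFun (h.inv_mul) 0)
  have h0 := hinv 0
  have h1 := hinv 1
  simp only [Matrix.mul_apply, Fin.sum_univ_two, one_apply_eq, ne_eq, zero_ne_one,
    not_false_eq_true, one_apply_ne] at h0 h1
  have hn : (h⁻¹).1 0 1 ≠ 0 := fun hn => by
    rw [hn, zero_mul, add_zero] at h0 h1
    rw [(mul_eq_zero.mp h1).resolve_right hb, zero_mul] at h0
    exact zero_ne_one h0
  have hkh : k.1 = !![1, 0; (h⁻¹).1 0 0, (h⁻¹).1 0 1] * h.1 := by
    ext i j
    fin_cases i <;> fin_cases j <;>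
      simp [hk, Matrix.mul_apply, Fin.sum_univ_two, -coe_units_inv, h0, h1]
  have hkh' : k.1 * (h⁻¹).1 = !![1, 0; (h⁻¹).1 0 0, (h⁻¹).1 0 1] := by
    rw [hkh, mul_assoc, h.mul_inv, mul_one]
  refine isGorensteinImage_of_conj k (isGorensteinImage_of_transvection_mem fun i j hij c => ?_)
  have h01 : (0 : Fin 2) ≠ 1 := by decide
  obtain ⟨rfl, rfl⟩ | ⟨rfl, rfl⟩ : i = 0 ∧ j = 1 ∨ i = 1 ∧ j = 0 := by omega
  · refine exists_mem_eq_transvection h01 hb ⟨_, Subgroup.mem_map_of_mem _ hu, conj_val_eq ?_⟩ c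
    rw [huU, hk]
    ext i j
    fin_cases i <;> fin_cases j <;> simp [transvection, Matrix.mul_apply, Fin.sum_univ_two]
  · refine exists_mem_eq_transvection h01.symm hn ⟨_, Subgroup.mem_map_of_mem _
      (H.mul_mem (H.mul_mem (H.inv_mem hh) hu) hh), conj_val_eq ?_⟩ c
    rw [Units.val_mul, Units.val_mul, ← mul_assoc, ← mul_assoc, hkh', huU]
    conv_rhs => rw [hkh, ← mul_assoc]
    congr 1
    ext i j
    fin_cases i <;> fin_cases j <;>
      simp [transvection, Matrix.mul_apply, Fin.sum_univ_two, add_comm]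

theorem exists_conj_eq_transvection {g : GL (Fin 2) (ZMod p)} (hg : orderOf g = p) :
    ∃ k : GL (Fin 2) (ZMod p), (MulAut.conj k g).1 = transvection 1 0 1 := by
  suffices h : ∃ K : Matrix (Fin 2) (Fin 2) (ZMod p),
      K.det ≠ 0 ∧ K * g.1 = transvection 1 0 1 * K by
    obtain ⟨K, hK, hKg⟩ := h
    exact ⟨GeneralLinearGroup.mkOfDetNeZero K hK, conj_val_eq hKg⟩
  have hN : IsNilpotent (g.1 - 1) := by
    refine ⟨p, ?_⟩
    rw [sub_pow_char_of_commute _ (Commute.one_right _), one_pow, ← Units.val_pow_eq_pow_val,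
      orderOf_dvd_iff_pow_eq_one.mp hg.dvd, Units.val_one, sub_self]
  have htr := (Matrix.isNilpotent_trace_of_isNilpotent hN).eq_zero
  have hdet : (g.1 - 1).det = 0 := by
    obtain ⟨n, hn⟩ := hN
    refine eq_zero_of_pow_eq_zero (n := n) ?_
    rw [← det_pow, hn, det_zero]
  obtain ⟨a, b, c, d, hgN⟩ : ∃ a b c d, g.1 = !![1 + a, b; c, 1 + d] :=
    ⟨_, _, _, _, (eta_fin_two g.1).trans (by
      congr <;> exact (add_sub_cancel _ _).symm)⟩
  have hd : d = -a := by
    rw [hgN] at htr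
    simp [trace_fin_two] at htr
    linear_combination htr
  have hbc : b * c = -a ^ 2 := by
    rw [hgN] at hdet
    simp [det_fin_two] at hdet
    linear_combination a * hd - hdet
  by_cases hb : b = 0
  · have ha : a = 0 := by simpa [hb] using hbc
    have hc : c ≠ 0 := fun hc => by
      have hg1 : g = 1 := Units.ext (by simp [hgN, ha, hb, hc, hd, one_fin_two])
      rw [hg1, orderOf_one] at hg
      exact (Fact.out : p.Prime).ne_one hg.symm
    refine ⟨!![c, 0; 0, 1], by simpa [det_fin_two] using hc, ?_⟩
    rw [hgN]
    ext i j
    fin_cases i <;> fin_cases j <;>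
      simp [transvection, Matrix.mul_apply, Fin.sum_univ_two, hb, hd, ha]
  · refine ⟨!![a, b; 1, 0], by simpa [det_fin_two] using hb, ?_⟩
    rw [hgN]
    ext i j
    fin_cases i <;> fin_cases j <;>
      simp [transvection, Matrix.mul_apply, Fin.sum_univ_two, hd, hbc] <;> ring

theorem isGorensteinImage_fixed (H : Subgroup (GL (Fin 2) (ZMod p))) :
    IsGorensteinImage {t : TriPoly p | ∀ h ∈ H, triAct h.1 t = t} := by
  by_cases hH : p ∣ Nat.card H
  · obtain ⟨g, hg⟩ := exists_prime_orderOf_dvd_card' p hH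
    rw [← Subgroup.orderOf_coe] at hg
    obtain ⟨k, hk⟩ := exists_conj_eq_transvection hg
    exact isGorensteinImage_of_conj k
      (isGorensteinImage_of_transvection_one_mem ⟨_, ⟨g.1, g.2, rfl⟩, hk⟩)
  · exact isGorensteinImage_of_not_dvd_card H hH

end TriPoly

theorem aeval_linearCombination {F A : Type*} [CommRing F] [CommRing A] [Algebra F A] {m : ℕ}
    (y : Fin m → A) (M : Matrix (Fin m) (Fin m) F) (u : Fin m → F) :
    MvPolynomial.aeval (fun i => Fintype.linearCombination F y (M i))
      (Fintype.linearCombination F (X (R := F)) u) =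
        Fintype.linearCombination F y (u ᵥ* M) := by
  simp only [Fintype.linearCombination_apply, map_sum, map_smul, aeval_X, Finset.smul_sum,
    vecMul, dotProduct, Finset.sum_smul, smul_smul]
  exact Finset.sum_comm

theorem polyAct_linearCombination {F : Type u} [CommRing F] {m : ℕ}
    (M : Matrix (Fin m) (Fin m) F) (u : Fin m → F) :
    polyAct M (Fintype.linearCombination F (X (R := F)) u) =
      Fintype.linearCombination F (X (R := F)) (u ᵥ* M) :=
  aeval_linearCombination _ _ _

section TriPoly

variable {p : ℕ} [Fact p.Prime]

theorem isGorensteinImage_fixed_set (S : Set (GL (Fin 2) (ZMod p))) :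
    IsGorensteinImage {t : TriPoly p | ∀ h ∈ S, triAct h.1 t = t} := by
  convert isGorensteinImage_fixed (Subgroup.closure S) using 1
  ext t
  exact ⟨triAct_eq_of_mem_closure, fun h s hs => h s (Subgroup.subset_closure hs)⟩

/-- The linear change of coordinates given by the rows of a matrix. -/
def triCoord (P : Matrix (Fin 3) (Fin 3) (ZMod p)) :
    TriPoly p →+* MvPolynomial (Fin 3) (ZMod p) :=
  triSubst (Fintype.linearCombination _ X (P 0)) (Fintype.linearCombination _ X (P 1))
    (Fintype.linearCombination _ X (P 2))

theorem triCoord_apply_vars (P : Matrix (Fin 3) (Fin 3) (ZMod p)) (i : Fin 3) :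
    triCoord P (![triZ, triX, triY] i) = Fintype.linearCombination (ZMod p) X (P i) := by
  fin_cases i
  · exact triSubst_Z _ _ _
  · exact triSubst_X _ _ _
  · exact triSubst_Y _ _ _

theorem triCoord_linearCombination (P : Matrix (Fin 3) (Fin 3) (ZMod p)) (u : Fin 3 → ZMod p) :
    triCoord P (Fintype.linearCombination (ZMod p) ![triZ, triX, triY] u) =
      Fintype.linearCombination (ZMod p) X (u ᵥ* P) := by
  have h (c : ZMod p) (t : TriPoly p) : triCoord P (c • t) = c • triCoord P t :=
    ZMod.map_smul (triCoord P).toAddMonoidHom c t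
  simp only [Fintype.linearCombination_apply, map_sum, h, triCoord_apply_vars, Finset.smul_sum,
    vecMul, dotProduct, Finset.sum_smul, smul_smul]
  exact Finset.sum_comm

theorem triCoord_bijective {P : Matrix (Fin 3) (Fin 3) (ZMod p)} (hP : IsUnit P) :
    Function.Bijective (triCoord P) := by
  obtain ⟨P, rfl⟩ := hP
  have hrow {M N : Matrix (Fin 3) (Fin 3) (ZMod p)} (h : M * N = 1) (i : Fin 3) :
      M i ᵥ* N = (Pi.single i 1 : Fin 3 → ZMod p) := by
    rw [← Matrix.mul_apply_eq_vecMul, h]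
    funext j
    simp [Matrix.one_apply, Pi.single_apply, eq_comm]
  let e' : MvPolynomial (Fin 3) (ZMod p) →ₐ[ZMod p] TriPoly p := MvPolynomial.aeval fun i =>
    Fintype.linearCombination (ZMod p) ![triZ, triX, triY] ((P⁻¹).1 i)
  refine Function.bijective_iff_has_inverse.mpr ⟨e', fun t => ?_, fun f => ?_⟩
  · have h (i) : e' (triCoord P.1 (![triZ, triX, triY] i)) = ![triZ, triX, triY] i := by
      rw [triCoord_apply_vars, aeval_linearCombination, hrow P.mul_inv,
        Fintype.linearCombination_apply_single, one_smul]
    exact RingHom.congr_fun (f := e'.toRingHom.comp (triCoord P.1)) (g := RingHom.id _)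
      (triPoly_hom_ext (h 0) (h 1) (h 2)) t
  · refine RingHom.congr_fun (f := (triCoord P.1).comp e'.toRingHom) (g := RingHom.id _)
      (MvPolynomial.ringHom_ext' (Subsingleton.elim _ _) fun i => ?_) f
    have h : e' (X i) = _ := MvPolynomial.aeval_X _ i
    refine (congrArg (triCoord P.1) h).trans ?_
    rw [triCoord_linearCombination, hrow P.inv_mul, Fintype.linearCombination_apply_single,
      one_smul]
    rfl

theorem polyAct_triCoord {P g : Matrix (Fin 3) (Fin 3) (ZMod p)} {ζ : ZMod p}
    {h : Matrix (Fin 2) (Fin 2) (ZMod p)} (h0 : P 0 ᵥ* g = ζ • P 0)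
    (h1 : P 1 ᵥ* g = h 0 0 • P 1 + h 0 1 • P 2) (h2 : P 2 ᵥ* g = h 1 0 • P 1 + h 1 1 • P 2)
    (t : TriPoly p) : polyAct g (triCoord P t) = triCoord P (triLin ζ h t) := by
  have hC (c : ZMod p) (t : TriPoly p) : triCoord P (triC c * t) = c • triCoord P t := by
    rw [triC, ← Algebra.smul_def]
    exact ZMod.map_smul (triCoord P).toAddMonoidHom c t
  have hv := triCoord_apply_vars P
  refine RingHom.congr_fun (f := (polyAct g).toRingHom.comp (triCoord P))
    (g := (triCoord P).comp (triLin ζ h)) (triPoly_hom_ext ?_ ?_ ?_) t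
  · refine (congrArg (polyAct g) (hv 0)).trans ?_
    rw [polyAct_linearCombination, h0, map_smul, RingHom.comp_apply, triLin_Z, hC, ← hv 0]
    rfl
  · refine (congrArg (polyAct g) (hv 1)).trans ?_
    rw [polyAct_linearCombination, h1, map_add, map_smul, map_smul, RingHom.comp_apply, triLin_X,
      map_add, hC, hC, ← hv 1, ← hv 2]
    rfl
  · refine (congrArg (polyAct g) (hv 2)).trans ?_
    rw [polyAct_linearCombination, h2, map_add, map_smul, map_smul, RingHom.comp_apply, triLin_Y,
      map_add, hC, hC, ← hv 1, ← hv 2]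
    rfl

theorem mul_det_eq_one {P g : Matrix (Fin 3) (Fin 3) (ZMod p)} (hP : IsUnit P) (hg : g.det = 1)
    {ζ : ZMod p} {h : Matrix (Fin 2) (Fin 2) (ZMod p)} (h0 : P 0 ᵥ* g = ζ • P 0)
    (h1 : P 1 ᵥ* g = h 0 0 • P 1 + h 0 1 • P 2) (h2 : P 2 ᵥ* g = h 1 0 • P 1 + h 1 1 • P 2) :
    ζ * h.det = 1 := by
  have hPg : P * g = !![ζ, 0, 0; 0, h 0 0, h 0 1; 0, h 1 0, h 1 1] * P := by
    ext i j
    rw [Matrix.mul_apply_eq_vecMul]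
    fin_cases i
    · simp [h0, Matrix.mul_apply, Fin.sum_univ_three]
    · simp [h1, Matrix.mul_apply, Fin.sum_univ_three]
    · simp [h2, Matrix.mul_apply, Fin.sum_univ_three]
  have hdet := congrArg Matrix.det hPg
  rw [det_mul, det_mul, hg, mul_comm] at hdet
  have := mul_right_cancel₀ ((P.isUnit_iff_isUnit_det.mp hP).ne_zero) hdet
  rw [this, det_fin_three, det_fin_two]
  simp
  ring

end TriPoly

/-- If `G ⊆ SL(3, 𝔽_p)` and `V = 𝔽_p³ = 𝔽_p·v ⊕ W` is a decomposition into
`G`-submodules with `dim W = 2`, then `S(V)^G` is Gorenstein. -/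
theorem stmt8 (p : ℕ) [Fact p.Prime]
    (G : Subgroup (Matrix.SpecialLinearGroup (Fin 3) (ZMod p)))
    (v : Fin 3 → ZMod p) (hv : v ≠ 0)
    (W : Submodule (ZMod p) (Fin 3 → ZMod p)) (hdimW : Module.finrank (ZMod p) W = 2)
    (hvG : ∀ g ∈ G, v ᵥ* (g : Matrix (Fin 3) (Fin 3) (ZMod p)) ∈
      Submodule.span (ZMod p) ({v} : Set (Fin 3 → ZMod p)))
    (hWG : ∀ g ∈ G, ∀ x ∈ W, x ᵥ* (g : Matrix (Fin 3) (Fin 3) (ZMod p)) ∈ W)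
    (hcompl : IsCompl (Submodule.span (ZMod p) ({v} : Set (Fin 3 → ZMod p))) W) :
    IsGorensteinRing ↥(invariantRing G) := by
  let b := Module.finBasisOfFinrankEq (ZMod p) W hdimW
  let P : Matrix (Fin 3) (Fin 3) (ZMod p) := Matrix.of (Fin.cons v fun i => (b i : Fin 3 → ZMod p))
  have hP : IsUnit P := by
    refine Matrix.linearIndependent_rows_iff_isUnit.mp (linearIndependent_finCons.mpr
      ⟨b.linearIndependent.map' W.subtype W.ker_subtype, fun hmem => hv ?_⟩)
    refine Submodule.disjoint_def.mp hcompl.disjoint v (Submodule.mem_span_singleton_self v)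
      (Submodule.span_le.mpr ?_ hmem)
    rintro _ ⟨i, rfl⟩
    exact (b i).2
  have hbij := triCoord_bijective hP
  have key (g) (hg : g ∈ G) : ∃ h : GL (Fin 2) (ZMod p), ∀ t : TriPoly p,
      polyAct g.1 (triCoord P t) = triCoord P (triAct h.1 t) := by
    obtain ⟨ζ, hζ⟩ := Submodule.mem_span_singleton.mp (hvG g hg)
    let h : Matrix (Fin 2) (Fin 2) (ZMod p) := Matrix.of fun i =>
      b.repr ⟨(b i : Fin 3 → ZMod p) ᵥ* g.1, hWG g hg _ (b i).2⟩
    have hh (i : Fin 2) : (b i : Fin 3 → ZMod p) ᵥ* g.1 = h i 0 • (b 0).1 + h i 1 • (b 1).1 := by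
      have := congrArg Subtype.val (b.sum_repr ⟨(b i).1 ᵥ* g.1, hWG g hg _ (b i).2⟩)
      rw [Fin.sum_univ_two] at this
      exact this.symm
    have hdet := mul_det_eq_one (P := P) hP g.2 hζ.symm (hh 0) (hh 1)
    refine ⟨GeneralLinearGroup.mkOfDetNeZero h (right_ne_zero_of_mul_eq_one hdet), fun t => ?_⟩
    exact (polyAct_triCoord (P := P) hζ.symm (hh 0) (hh 1) t).trans
      (congrArg (fun c => triCoord P (triLin c h t)) (eq_inv_of_mul_eq_one_left hdet))
  refine IsGorensteinImage.of_preimage (S := {f | ∀ g ∈ G, polyAct g.1 f = f}) (triCoord P)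
    hbij.injective (fun f _ => hbij.surjective f) ?_ _ (invariantRing G).val.toRingHom
    Subtype.val_injective ?_
  · convert isGorensteinImage_fixed_set {h : GL (Fin 2) (ZMod p) | ∃ g ∈ G, ∀ t : TriPoly p,
      polyAct g.1 (triCoord P t) = triCoord P (triAct h.1 t)} using 1
    ext t
    simp only [Set.mem_preimage, Set.mem_ofPred_eq]
    constructor
    · rintro ht h ⟨g, hg, hgh⟩
      exact hbij.injective ((hgh t).symm.trans (ht g hg))
    · intro ht g hg
      obtain ⟨h, hgh⟩ := key g hg
      rw [hgh, ht h ⟨g, hg, hgh⟩]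
  · refine Subtype.range_val.trans (Set.ext fun f => ?_)
    exact ⟨fun hf g hg => hf _ ⟨g, hg, rfl⟩, fun hf _ ⟨g, hg, hgM⟩ => hgM ▸ hf g hg⟩

end
end

section
/- Let F be a field of characteristic p > 0, V a 3-dimensional F-vector space, and G ⊆ SL(V) a finite subgroup such that V contains two distinct 2-dimensional G-submodules W₁ and W₂. Then T(G), the subgroup of G generated by all transvections of G, is an elementary abelian p-group (it is abelian and every nontrivial element has order p). -/
noncomputable section
open CategoryTheory Matrix MvPolynomial

universe u

/-- A linear endomorphism is a transvection if `rank (σ - 1) = 1` and `(σ - 1)² = 0`. -/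
def IsTransvectionMap {F : Type u} [Field F] {V : Type u} [AddCommGroup V] [Module F V]
    (σ : V →ₗ[F] V) : Prop :=
  Module.finrank F (LinearMap.range (σ - LinearMap.id)) = 1 ∧
    (σ - LinearMap.id) ∘ₗ (σ - LinearMap.id) = 0

/-- A square-zero endomorphism preserving `A ≤ B`, where `B` has one more dimension than `A`,
maps `B` into `A`. -/
theorem apply_mem_of_sq_zero {F V : Type*} [Field F] [AddCommGroup V] [Module F V]
    [FiniteDimensional F V] {A B : Submodule F V} (hAB : A ≤ B)
    (hdim : Module.finrank F B = Module.finrank F A + 1) (N : V →ₗ[F] V)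
    (hN : ∀ x, N (N x) = 0) (hA : ∀ x ∈ A, N x ∈ A) (hB : ∀ x ∈ B, N x ∈ B) :
    ∀ x ∈ B, N x ∈ A := by
  have hlt : A < B := lt_of_le_of_ne hAB (by rintro rfl; omega)
  obtain ⟨b, hbB, hbA⟩ := SetLike.exists_of_lt hlt
  have hsup : A ⊔ F ∙ b = B := by
    refine Submodule.eq_of_le_of_finrank_le
      (sup_le hAB ((Submodule.span_singleton_le_iff_mem b B).2 hbB)) ?_
    have : A < A ⊔ F ∙ b := lt_of_le_of_ne le_sup_left fun h =>
      hbA (h ▸ Submodule.mem_sup_right (Submodule.mem_span_singleton_self b))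
    have := Submodule.finrank_lt_finrank_of_lt this
    omega
  have decomp : ∀ x ∈ B, ∃ a ∈ A, ∃ c : F, a + c • b = x := by
    intro x hx
    rw [← hsup, Submodule.mem_sup] at hx
    obtain ⟨a, ha, y, hy, rfl⟩ := hx
    obtain ⟨c, rfl⟩ := Submodule.mem_span_singleton.1 hy
    exact ⟨a, ha, c, rfl⟩
  have hNb : N b ∈ A := by
    obtain ⟨a, ha, c, hc⟩ := decomp (N b) (hB b hbB)
    by_cases h0 : c = 0
    · simpa [← hc, h0] using ha
    have h := hN b
    rw [← hc, map_add, map_smul] at h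
    have hcNb : c • N b ∈ A := by
      rw [eq_neg_of_add_eq_zero_right h]
      exact A.neg_mem (hA a ha)
    exact (A.smul_mem_iff h0).1 hcNb
  intro x hx
  obtain ⟨a, ha, c, rfl⟩ := decomp x hx
  rw [map_add, map_smul]
  exact A.add_mem (hA a ha) (A.smul_mem c hNb)

/-- The linear automorphisms that act trivially on `L` and on `V ⧸ L`. -/
def stabilizerOfChain {F V : Type*} [Field F] [AddCommGroup V] [Module F V]
    (L : Submodule F V) : Subgroup (V ≃ₗ[F] V) where
  carrier := {σ | (∀ x, σ x - x ∈ L) ∧ ∀ x ∈ L, σ x = x}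
  one_mem' := ⟨fun x => by simp, fun x _ => rfl⟩
  mul_mem' := by
    rintro σ τ ⟨hσ, hσL⟩ ⟨hτ, hτL⟩
    refine ⟨fun x => ?_, fun x hx => ?_⟩
    · rw [LinearEquiv.mul_apply, ← sub_add_sub_cancel (σ (τ x)) (τ x) x]
      exact L.add_mem (hσ _) (hτ _)
    · rw [LinearEquiv.mul_apply, hτL x hx, hσL x hx]
  inv_mem' := by
    rintro σ ⟨hσ, hσL⟩
    refine ⟨fun x => ?_, fun x hx => ?_⟩
    · have h := L.neg_mem (hσ (σ⁻¹ x))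
      rw [← LinearEquiv.mul_apply, mul_inv_cancel, neg_sub] at h
      exact h
    · conv_lhs => rw [← hσL x hx]
      rw [← LinearEquiv.mul_apply, inv_mul_cancel]
      rfl

theorem stabilizerOfChain_mul_comm {F V : Type*} [Field F] [AddCommGroup V] [Module F V]
    {L : Submodule F V} {σ τ : V ≃ₗ[F] V} (hσ : σ ∈ stabilizerOfChain L)
    (hτ : τ ∈ stabilizerOfChain L) : σ * τ = τ * σ := by
  ext x
  have h₁ := hσ.2 _ (hτ.1 x)
  have h₂ := hτ.2 _ (hσ.1 x)
  rw [map_sub, sub_eq_iff_eq_add] at h₁ h₂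
  rw [LinearEquiv.mul_apply, LinearEquiv.mul_apply, h₁, h₂]
  abel

theorem stabilizerOfChain_pow_apply {F V : Type*} [Field F] [AddCommGroup V] [Module F V]
    {L : Submodule F V} {σ : V ≃ₗ[F] V} (hσ : σ ∈ stabilizerOfChain L) (n : ℕ) (x : V) :
    (σ ^ n) x = x + n • (σ x - x) := by
  induction n with
  | zero => simp
  | succ n ih =>
    rw [pow_succ', LinearEquiv.mul_apply, ih, map_add, map_nsmul, hσ.2 _ (hσ.1 x), succ_nsmul]
    abel

theorem stabilizerOfChain_pow_char (p : ℕ) {F V : Type*} [Field F] [CharP F p] [AddCommGroup V]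
    [Module F V] {L : Submodule F V} {σ : V ≃ₗ[F] V} (hσ : σ ∈ stabilizerOfChain L) :
    σ ^ p = 1 := by
  ext x
  rw [stabilizerOfChain_pow_apply hσ, ← Nat.cast_smul_eq_nsmul F, CharP.cast_eq_zero, zero_smul,
    add_zero]
  rfl

/-- An automorphism `σ` of a 3-dimensional space with `(σ - 1)² = 0` that preserves two distinct
planes acts trivially on their intersection and on the quotient by it. -/
theorem mem_stabilizerOfChain_of_sq_zero {F V : Type*} [Field F] [AddCommGroup V] [Module F V]
    [FiniteDimensional F V] (hdimV : Module.finrank F V = 3) {W₁ W₂ : Submodule F V}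
    (hW₁ : Module.finrank F W₁ = 2) (hW₂ : Module.finrank F W₂ = 2) (hne : W₁ ≠ W₂)
    {σ : V ≃ₗ[F] V} (h₁ : ∀ x ∈ W₁, σ x ∈ W₁) (h₂ : ∀ x ∈ W₂, σ x ∈ W₂)
    (hσ : ((σ : V →ₗ[F] V) - LinearMap.id) ∘ₗ ((σ : V →ₗ[F] V) - LinearMap.id) = 0) :
    σ ∈ stabilizerOfChain (W₁ ⊓ W₂) := by
  have hlt : W₁ < W₁ ⊔ W₂ := lt_of_le_of_ne le_sup_left fun h =>
    hne (Submodule.eq_of_le_of_finrank_eq (sup_eq_left.1 h.symm) (hW₂.trans hW₁.symm)).symm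
  have hsup := Submodule.finrank_lt_finrank_of_lt hlt
  have hle := Submodule.finrank_le (W₁ ⊔ W₂)
  have hadd := Submodule.finrank_sup_add_finrank_inf_eq W₁ W₂
  have htop : W₁ ⊔ W₂ = ⊤ := Submodule.eq_top_of_finrank_eq (by omega)
  have hL : Module.finrank F ↥(W₁ ⊓ W₂) = 1 := by omega
  set N : V →ₗ[F] V := (σ : V →ₗ[F] V) - LinearMap.id
  have hN : ∀ x, N (N x) = 0 := fun x => LinearMap.congr_fun hσ x
  have hN₁ : ∀ x ∈ W₁, N x ∈ W₁ := fun x hx => W₁.sub_mem (h₁ x hx) hx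
  have hN₂ : ∀ x ∈ W₂, N x ∈ W₂ := fun x hx => W₂.sub_mem (h₂ x hx) hx
  have hNL : ∀ x ∈ W₁ ⊓ W₂, N x ∈ W₁ ⊓ W₂ := fun x hx => ⟨hN₁ x hx.1, hN₂ x hx.2⟩
  refine ⟨fun x => ?_, fun x hx => ?_⟩
  · change N x ∈ W₁ ⊓ W₂
    obtain ⟨y, hy, z, hz, rfl⟩ := Submodule.mem_sup.1 (htop ▸ Submodule.mem_top : x ∈ W₁ ⊔ W₂)
    rw [map_add]
    exact add_mem (apply_mem_of_sq_zero inf_le_left (by omega) N hN hNL hN₁ y hy)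
      (apply_mem_of_sq_zero inf_le_right (by omega) N hN hNL hN₂ z hz)
  · have h := apply_mem_of_sq_zero (A := ⊥) bot_le (by rw [hL, finrank_bot]) N hN
      (by simp) hNL x hx
    exact sub_eq_zero.1 ((Submodule.mem_bot F).1 h)

/-- If the 3-dimensional `G`-module `V` contains two distinct 2-dimensional
`G`-submodules, then `T(G)` is an elementary abelian `p`-group. -/
theorem stmt9 (p : ℕ) [Fact p.Prime] (F : Type u) [Field F] [CharP F p]
    (V : Type u) [AddCommGroup V] [Module F V] [FiniteDimensional F V]
    (hdimV : Module.finrank F V = 3)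
    (G : Subgroup (V ≃ₗ[F] V)) [Finite G]
    (hSL : ∀ g ∈ G, LinearMap.det (↑g : V →ₗ[F] V) = 1)
    (W₁ W₂ : Submodule F V) (hW₁ : Module.finrank F W₁ = 2) (hW₂ : Module.finrank F W₂ = 2)
    (hne : W₁ ≠ W₂)
    (hG₁ : ∀ g ∈ G, ∀ x ∈ W₁, g x ∈ W₁) (hG₂ : ∀ g ∈ G, ∀ x ∈ W₂, g x ∈ W₂) :
    (∀ σ ∈ Subgroup.closure {σ : V ≃ₗ[F] V | σ ∈ G ∧ IsTransvectionMap (↑σ : V →ₗ[F] V)},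
      ∀ τ ∈ Subgroup.closure {σ : V ≃ₗ[F] V | σ ∈ G ∧ IsTransvectionMap (↑σ : V →ₗ[F] V)},
        σ * τ = τ * σ) ∧
    (∀ σ ∈ Subgroup.closure {σ : V ≃ₗ[F] V | σ ∈ G ∧ IsTransvectionMap (↑σ : V →ₗ[F] V)},
      σ ^ p = 1) := by
  have hmem : Subgroup.closure {σ : V ≃ₗ[F] V | σ ∈ G ∧ IsTransvectionMap (↑σ : V →ₗ[F] V)} ≤
      stabilizerOfChain (W₁ ⊓ W₂) :=
    (Subgroup.closure_le _).2 fun σ hσ =>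
      mem_stabilizerOfChain_of_sq_zero hdimV hW₁ hW₂ hne (hG₁ σ hσ.1) (hG₂ σ hσ.1) hσ.2.2
  exact ⟨fun σ hσ τ hτ => stabilizerOfChain_mul_comm (hmem hσ) (hmem hτ),
    fun σ hσ => stabilizerOfChain_pow_char p (hmem hσ)⟩

end
end
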